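/- Let n ≥ 3, p > n − 1, let 𝔹_u be a model inward-cusp ball, let h : 𝔹 → 𝔹_u be a homeomorphism of finite conformal energy whose inverse f = h⁻¹ belongs to W^{1,p}(𝔹_u, ℝⁿ), and let H : cl(𝔹) → cl(𝔹_u) be a continuous extension of h. Then for almost every t ∈ (0,1) the set ∂𝔹 ∖ C′_t consists of exactly two disjoint nonempty connected sets, open in ∂𝔹, whose common boundary (relative to ∂𝔹) is C′_t; here S_t = {y ∈ 𝔹_u : |y| = t}, S′_t = h⁻¹(S_t), and C′_t = cl(S′_t) ∩ ∂𝔹. -/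

import Mathlib

open MeasureTheory Metric Set
open scoped ENNReal NNReal

noncomputable section

abbrev Euc (n : ℕ) : Type := EuclideanSpace ℝ (Fin n)

/-- Operator norm of an `n × n` real matrix, viewed as a linear operator on Euclidean space. -/
noncomputable def opNorm {n : ℕ} (M : Matrix (Fin n) (Fin n) ℝ) : ℝ :=
  ‖LinearMap.toContinuousLinearMap (Matrix.toEuclideanLin M)‖

/-- `g` belongs to the Sobolev class `W^{1,p}(Ω, ℝⁿ)` with weak differential `Dg`:
`g` and `Dg` are locally integrable on `Ω`, the integration-by-parts identity holds against
every smooth compactly supported test function supported in `Ω`, and `|Dg| ∈ L^p(Ω)`. -/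
structure MemSobolev {n : ℕ} (p : ℝ) (Ω : Set (Euc n))
    (g : Euc n → Euc n) (Dg : Euc n → Matrix (Fin n) (Fin n) ℝ) : Prop where
  locInt : ∀ i : Fin n, LocallyIntegrableOn (fun x => g x i) Ω volume
  locIntD : ∀ i j : Fin n, LocallyIntegrableOn (fun x => Dg x i j) Ω volume
  parts : ∀ φ : Euc n → ℝ, ContDiff ℝ ((⊤ : ℕ∞) : WithTop ℕ∞) φ → HasCompactSupport φ →
    tsupport φ ⊆ Ω → ∀ i j : Fin n,
      ∫ x in Ω, g x i * fderiv ℝ φ x (EuclideanSpace.single j 1) =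
        - ∫ x in Ω, Dg x i j * φ x
  lp : IntegrableOn (fun x => opNorm (Dg x) ^ p) Ω volume

/-- `g` belongs to the local Sobolev class `W^{1,1}_loc(Ω, ℝⁿ)` with weak differential `Dg`. -/
structure MemSobolevLoc {n : ℕ} (Ω : Set (Euc n))
    (g : Euc n → Euc n) (Dg : Euc n → Matrix (Fin n) (Fin n) ℝ) : Prop where
  locInt : ∀ i : Fin n, LocallyIntegrableOn (fun x => g x i) Ω volume
  locIntD : ∀ i j : Fin n, LocallyIntegrableOn (fun x => Dg x i j) Ω volume
  parts : ∀ φ : Euc n → ℝ, ContDiff ℝ ((⊤ : ℕ∞) : WithTop ℕ∞) φ → HasCompactSupport φ →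
    tsupport φ ⊆ Ω → ∀ i j : Fin n,
      ∫ x in Ω, g x i * fderiv ℝ φ x (EuclideanSpace.single j 1) =
        - ∫ x in Ω, Dg x i j * φ x

/-- `h : 𝕏 → 𝕐` is a homeomorphism of `𝕏` onto `𝕐` with inverse `f`. -/
structure IsHomeoOn {n : ℕ} (h f : Euc n → Euc n) (𝕏 𝕐 : Set (Euc n)) : Prop where
  mapsTo : Set.MapsTo h 𝕏 𝕐
  mapsTo_inv : Set.MapsTo f 𝕐 𝕏
  left_inv : ∀ x ∈ 𝕏, f (h x) = x
  right_inv : ∀ y ∈ 𝕐, h (f y) = y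
  continuousOn : ContinuousOn h 𝕏
  continuousOn_inv : ContinuousOn f 𝕐

/-- The inner distortion function `K_I(·, h)` of a Sobolev map with weak differential `Dh`;
`D♯h` is the cofactor (adjugate) matrix, given by Cramer's rule `(D♯h)(Dh) = (det Dh)·Id`. -/
noncomputable def innerDistortion {n : ℕ} (Dh : Euc n → Matrix (Fin n) (Fin n) ℝ)
    (x : Euc n) : ℝ≥0∞ :=
  if 0 < (Dh x).det then
    ENNReal.ofReal (opNorm ((Dh x).adjugate) ^ n / (Dh x).det ^ (n - 1))
  else if (Dh x).adjugate = 0 then 1 else ⊤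

/-- The open unit ball `𝔹 ⊂ ℝⁿ`. -/
def unitBall (n : ℕ) : Set (Euc n) := Metric.ball 0 1

/-- The slit `I = {(t,0) : 0 ≤ t < 1}`, the first coordinate playing the role of `t`. -/
def slit (n : ℕ) [NeZero n] : Set (Euc n) :=
  {p | 0 ≤ p 0 ∧ p 0 < 1 ∧ ∀ i : Fin n, i ≠ 0 → p i = 0}

/-- The model inward-cusp ball `𝔹_u = 𝔹 \ {(t,x) : t ≥ 0, |x| ≤ u(t)}`. -/
noncomputable def cuspBall (n : ℕ) [NeZero n] (u : ℝ → ℝ) : Set (Euc n) :=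
  Metric.ball 0 1 \
    {p | 0 ≤ p 0 ∧ Real.sqrt (∑ i ∈ Finset.univ.erase (0 : Fin n), p i ^ 2) ≤ u (p 0)}

/-- `u` is a model cusp profile: a strictly increasing continuous surjection of `[0,∞)` onto
itself, `C¹` on `(0,∞)`, with `u′` increasing on `(0,∞)`, `u′(s) → 0` as `s → 0⁺`, `u(1) = 1`. -/
structure IsModelCusp (u : ℝ → ℝ) : Prop where
  continuousOn : ContinuousOn u (Set.Ici 0)
  contDiffOn : ContDiffOn ℝ 1 u (Set.Ioi 0)
  strictMonoOn : StrictMonoOn u (Set.Ici 0)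
  mapsTo : Set.MapsTo u (Set.Ici 0) (Set.Ici 0)
  surjOn : Set.SurjOn u (Set.Ici 0) (Set.Ici 0)
  deriv_mono : MonotoneOn (deriv u) (Set.Ioi 0)
  deriv_tendsto : Filter.Tendsto (deriv u) (nhdsWithin 0 (Set.Ioi 0)) (nhds 0)
  one : u 1 = 1

/-- The cusp profile `u(t) = e / exp(t^{-α})` for `t > 0`, and `u(0) = 0`. -/
noncomputable def cuspFun (α : ℝ) (t : ℝ) : ℝ :=
  if 0 < t then Real.exp 1 / Real.exp (t ^ (-α)) else 0

/-- The sphere `S_t = {y ∈ 𝔹_u : |y| = t}` inside the cusp ball. -/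
def cuspS (n : ℕ) [NeZero n] (u : ℝ → ℝ) (t : ℝ) : Set (Euc n) :=
  {y ∈ cuspBall n u | ‖y‖ = t}

/-- The boundary circle `C_t = {y ∈ ∂𝔹_u : |y| = t}`. -/
def cuspC (n : ℕ) [NeZero n] (u : ℝ → ℝ) (t : ℝ) : Set (Euc n) :=
  {y ∈ frontier (cuspBall n u) | ‖y‖ = t}

/-- `S′_t = h⁻¹(S_t) ⊆ 𝔹`. -/
def cuspS' (n : ℕ) [NeZero n] (u : ℝ → ℝ) (h : Euc n → Euc n) (t : ℝ) : Set (Euc n) :=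
  {x ∈ unitBall n | h x ∈ cuspS n u t}

/-- `C′_t = cl(S′_t) ∩ ∂𝔹`. -/
def cuspC' (n : ℕ) [NeZero n] (u : ℝ → ℝ) (h : Euc n → Euc n) (t : ℝ) : Set (Euc n) :=
  closure (cuspS' n u h t) ∩ Metric.sphere (0 : Euc n) 1

/-! ### Coordinates -/

/-- The last `m` coordinates. -/
def tl {m : ℕ} (p : Euc (m + 1)) : Euc m := WithLp.toLp 2 (fun i => p i.succ)

/-- The point with first coordinate `s` and remaining coordinates `x`. -/
def pt {m : ℕ} (s : ℝ) (x : Euc m) : Euc (m + 1) :=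
  WithLp.toLp 2 (Fin.cons s (fun i => x i) : Fin (m + 1) → ℝ)

@[simp] lemma pt_zero {m : ℕ} (s : ℝ) (x : Euc m) : pt s x 0 = s := by simp [pt]
@[simp] lemma pt_succ {m : ℕ} (s : ℝ) (x : Euc m) (i : Fin m) : pt s x i.succ = x i := by
  simp [pt]
@[simp] lemma tl_apply {m : ℕ} (p : Euc (m + 1)) (i : Fin m) : tl p i = p i.succ := rfl
@[simp] lemma tl_pt {m : ℕ} (s : ℝ) (x : Euc m) : tl (pt s x) = x := by
  ext i; simp
lemma euc_ext {m : ℕ} {p q : Euc (m + 1)} (h0 : p 0 = q 0) (h1 : tl p = tl q) : p = q := by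
  ext i
  refine Fin.cases h0 (fun j => ?_) i
  have := congrArg (fun x : Euc m => x j) h1
  simpa using this
@[simp] lemma pt_tl {m : ℕ} (p : Euc (m + 1)) : pt (p 0) (tl p) = p :=
  euc_ext (by simp) (by simp)
lemma tl_add {m : ℕ} (p q : Euc (m + 1)) : tl (p + q) = tl p + tl q := by ext i; simp
lemma tl_sub {m : ℕ} (p q : Euc (m + 1)) : tl (p - q) = tl p - tl q := by ext i; simp
lemma tl_smul {m : ℕ} (a : ℝ) (p : Euc (m + 1)) : tl (a • p) = a • tl p := by ext i; simp
lemma norm_sq_eq {m : ℕ} (p : Euc (m + 1)) : ‖p‖ ^ 2 = p 0 ^ 2 + ‖tl p‖ ^ 2 := by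
  rw [EuclideanSpace.norm_sq_eq, EuclideanSpace.norm_sq_eq, Fin.sum_univ_succ]
  simp
lemma continuous_tl {m : ℕ} : Continuous (tl : Euc (m + 1) → Euc m) := by
  unfold tl; fun_prop
lemma continuous_fst' {m : ℕ} : Continuous (fun p : Euc (m + 1) => p 0) := by fun_prop
lemma continuous_pt {m : ℕ} : Continuous (fun q : ℝ × Euc m => pt q.1 q.2) := by
  unfold pt
  refine (PiLp.continuous_toLp 2 _).comp ?_
  refine continuous_pi fun i => ?_
  refine Fin.cases ?_ (fun j => ?_) i
  · simpa using continuous_fst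
  · simp only [Fin.cons_succ]; fun_prop
lemma norm_tl_le {m : ℕ} (p : Euc (m + 1)) : ‖tl p‖ ≤ ‖p‖ := by
  have := norm_sq_eq p
  nlinarith [norm_nonneg p, norm_nonneg (tl p), sq_nonneg (p 0)]
lemma abs_fst_le {m : ℕ} (p : Euc (m + 1)) : |p 0| ≤ ‖p‖ := by
  have := norm_sq_eq p
  refine abs_le_of_sq_le_sq ?_ (norm_nonneg _)
  nlinarith [sq_nonneg ‖tl p‖]

lemma mem_cuspBall {m : ℕ} {u : ℝ → ℝ} {p : Euc (m + 1)} :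
    p ∈ cuspBall (m + 1) u ↔ ‖p‖ < 1 ∧ (p 0 < 0 ∨ u (p 0) < ‖tl p‖) := by
  have h1 : Real.sqrt (∑ i ∈ Finset.univ.erase (0 : Fin (m + 1)), p i ^ 2) = ‖tl p‖ := by
    rw [EuclideanSpace.norm_eq]
    congr 1
    have := Finset.add_sum_erase (Finset.univ) (fun i : Fin (m + 1) => p i ^ 2)
      (Finset.mem_univ 0)
    rw [Fin.sum_univ_succ] at this
    simpa using add_left_cancel this
  simp only [cuspBall, mem_sdiff, mem_ball_zero_iff, mem_ofPred_eq, h1]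
  rw [not_and_or, not_le, not_le]

/-! ### The cusp profile -/

namespace IsModelCusp
variable {u : ℝ → ℝ}

lemma zero (hu : IsModelCusp u) : u 0 = 0 := by
  obtain ⟨s, hs, h0⟩ := hu.surjOn (show (0 : ℝ) ∈ Ici 0 by simp)
  have h1 : u 0 ≤ u s := hu.strictMonoOn.monotoneOn (by simp) hs hs
  have h2 : 0 ≤ u 0 := hu.mapsTo (by simp)
  linarith

lemma nonneg (hu : IsModelCusp u) {s : ℝ} (hs : 0 ≤ s) : 0 ≤ u s := hu.mapsTo hs

lemma pos (hu : IsModelCusp u) {s : ℝ} (hs : 0 < s) : 0 < u s := by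
  rw [← hu.zero]; exact hu.strictMonoOn (by simp) hs.le hs

lemma lt (hu : IsModelCusp u) {s t : ℝ} (hs : 0 ≤ s) (hst : s < t) : u s < u t :=
  hu.strictMonoOn hs (hs.trans hst.le) hst

lemma le (hu : IsModelCusp u) {s t : ℝ} (hs : 0 ≤ s) (hst : s ≤ t) : u s ≤ u t :=
  hu.strictMonoOn.monotoneOn hs (hs.trans hst) hst

lemma convexOn (hu : IsModelCusp u) : ConvexOn ℝ (Ici 0) u := by
  apply MonotoneOn.convexOn_of_deriv (convex_Ici 0) hu.continuousOn
  · rw [interior_Ici]; exact hu.contDiffOn.differentiableOn (by norm_num)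
  · rw [interior_Ici]; exact hu.deriv_mono

lemma mul_le (hu : IsModelCusp u) {t l : ℝ} (ht : 0 ≤ t) (hl : 0 ≤ l) (hl1 : l ≤ 1) :
    u (l * t) ≤ l * u t := by
  have := hu.convexOn.2 (x := t) (y := 0) ht (by simp) hl (sub_nonneg.2 hl1) (by ring)
  simpa [hu.zero] using this

lemma continuousAt (hu : IsModelCusp u) {t : ℝ} (ht : 0 < t) : ContinuousAt u t :=
  hu.continuousOn.continuousAt (Ici_mem_nhds ht)

end IsModelCusp

/-! ### The closed cusp ball -/

/-- Explicit description of the closure of the cusp ball. -/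
def cuspD (m : ℕ) (u : ℝ → ℝ) : Set (Euc (m + 1)) :=
  {p | ‖p‖ ≤ 1 ∧ (p 0 ≤ 0 ∨ u (p 0) ≤ ‖tl p‖)}

/-- Star center. -/
def ctr (m : ℕ) : Euc (m + 1) := pt (-(1 / 2)) 0

lemma norm_ctr (m : ℕ) : ‖ctr m‖ < 1 := by
  have := norm_sq_eq (ctr m)
  simp [ctr] at this
  unfold ctr
  nlinarith [norm_nonneg (pt (-2⁻¹) (0 : Euc m))]

lemma isClosed_cuspD {m : ℕ} {u : ℝ → ℝ} (hu : IsModelCusp u) : IsClosed (cuspD m u) := by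
  rw [← isOpen_compl_iff]
  have : (cuspD m u)ᶜ = {p | 1 < ‖p‖} ∪ {p | 0 < p 0 ∧ ‖tl p‖ < u (p 0)} := by
    ext p; simp only [cuspD, mem_compl_iff, mem_ofPred_eq, mem_union, not_and_or, not_le, not_or]
  rw [this]
  refine (isOpen_lt continuous_const continuous_norm).union ?_
  rw [isOpen_iff_mem_nhds]
  rintro p ⟨h1, h2⟩
  have c1 : ContinuousAt (fun p : Euc (m + 1) => u (p 0)) p :=
    ContinuousAt.comp (g := u) (hu.continuousAt h1) continuous_fst'.continuousAt
  have c2 : ContinuousAt (fun p : Euc (m + 1) => ‖tl p‖) p := continuous_tl.norm.continuousAt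
  filter_upwards [c2.eventually_lt c1 h2, (isOpen_lt continuous_const continuous_fst').mem_nhds h1]
    with q hq1 hq2 using ⟨hq2, hq1⟩

lemma isOpen_cuspBall {m : ℕ} {u : ℝ → ℝ} (hu : IsModelCusp u) :
    IsOpen (cuspBall (m + 1) u) := by
  have : cuspBall (m + 1) u = {p | ‖p‖ < 1} ∩ ({p | p 0 < 0} ∪ {p | u |p 0| < ‖tl p‖}) := by
    ext p
    simp only [mem_cuspBall, mem_inter_iff, mem_union, mem_ofPred_eq]
    refine and_congr_right fun _ => ?_
    rcases lt_or_ge (p 0) 0 with h | h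
    · simp [h]
    · rw [abs_of_nonneg h]
  rw [this]
  refine (isOpen_lt continuous_norm continuous_const).inter
    ((isOpen_lt continuous_fst' continuous_const).union (isOpen_lt ?_ continuous_tl.norm))
  exact hu.continuousOn.comp_continuous continuous_fst'.abs (fun p => mem_Ici.2 (abs_nonneg _))

lemma cuspBall_subset_cuspD {m : ℕ} {u : ℝ → ℝ} : cuspBall (m + 1) u ⊆ cuspD m u := by
  intro p hp
  rw [mem_cuspBall] at hp
  exact ⟨hp.1.le, hp.2.imp le_of_lt le_of_lt⟩

lemma cstar {m : ℕ} {u : ℝ → ℝ} (hu : IsModelCusp u) {y : Euc (m + 1)} (hy : y ∈ cuspD m u)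
    {l : ℝ} (hl : 0 ≤ l) (hl1 : l < 1) : (1 - l) • ctr m + l • y ∈ cuspBall (m + 1) u := by
  rw [mem_cuspBall]
  constructor
  · calc ‖(1 - l) • ctr m + l • y‖ ≤ ‖(1 - l) • ctr m‖ + ‖l • y‖ := norm_add_le _ _
      _ = (1 - l) * ‖ctr m‖ + l * ‖y‖ := by
        rw [norm_smul, norm_smul, Real.norm_of_nonneg hl, Real.norm_of_nonneg (by linarith)]
      _ < 1 := by
        have := norm_ctr m
        have := hy.1
        nlinarith [mul_nonneg hl (sub_nonneg.2 hy.1)]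
  · rw [tl_add, tl_smul, tl_smul]
    have e : ((1 - l) • ctr m + l • y) 0 = - (1 - l) / 2 + l * y 0 := by
      simp [ctr]; ring
    rw [e]
    have e2 : ‖(1 - l) • tl (ctr m) + l • tl y‖ = l * ‖tl y‖ := by
      simp [ctr, norm_smul, abs_of_nonneg hl]
    rw [e2]
    by_cases hz : - (1 - l) / 2 + l * y 0 < 0
    · exact Or.inl hz
    right
    push Not at hz
    have hpos : 0 < l * y 0 := by linarith
    have hy0 : 0 < y 0 := by
      by_contra hcon
      push Not at hcon
      nlinarith
    have h3 : u (y 0) ≤ ‖tl y‖ := hy.2.resolve_left (not_le.2 hy0)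
    calc u (- (1 - l) / 2 + l * y 0) < u (l * y 0) := hu.lt hz (by linarith)
      _ ≤ l * u (y 0) := hu.mul_le hy0.le hl hl1.le
      _ ≤ l * ‖tl y‖ := by gcongr

lemma tendsto_cstar {m : ℕ} (y : Euc (m + 1)) :
    Filter.Tendsto (fun l : ℝ => (1 - l) • ctr m + l • y) (nhdsWithin 1 (Ico 0 1)) (nhds y) := by
  have : Continuous (fun l : ℝ => (1 - l) • ctr m + l • y) := by fun_prop
  have h := this.tendsto 1
  simp only [sub_self, zero_smul, one_smul, zero_add] at h
  exact h.mono_left nhdsWithin_le_nhds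

instance neBot_Ico : (nhdsWithin (1 : ℝ) (Ico 0 1)).NeBot := by
  apply mem_closure_iff_nhdsWithin_neBot.1
  rw [closure_Ico (by norm_num)]; simp

lemma closure_cuspBall {m : ℕ} {u : ℝ → ℝ} (hu : IsModelCusp u) :
    closure (cuspBall (m + 1) u) = cuspD m u := by
  refine (closure_minimal cuspBall_subset_cuspD (isClosed_cuspD hu)).antisymm ?_
  intro y hy
  refine mem_closure_of_tendsto (tendsto_cstar y) ?_
  filter_upwards [self_mem_nhdsWithin] with l hl using cstar hu hy hl.1 hl.2

/-- Local connectedness at points of the closure. -/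
lemma local_conn {m : ℕ} {u : ℝ → ℝ} (hu : IsModelCusp u) {y : Euc (m + 1)}
    (hy : y ∈ cuspD m u) {r : ℝ} (hr : 0 < r) :
    ∃ W : Set (Euc (m + 1)), IsPreconnected W ∧ W ⊆ cuspBall (m + 1) u ∩ ball y r ∧
      ∃ d > 0, cuspBall (m + 1) u ∩ ball y d ⊆ W := by
  obtain ⟨l, ⟨hl0, hl1⟩, hl⟩ : ∃ l : ℝ, l ∈ Ico (0 : ℝ) 1 ∧
      (1 - l) • ctr m + l • y ∈ ball y (r / 2) := by
    have h1 := (tendsto_cstar y).eventually (ball_mem_nhds y (half_pos hr))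
    exact ((eventually_mem_nhdsWithin).and h1).exists
  set y' := (1 - l) • ctr m + l • y with hy'
  obtain ⟨e, he, heb⟩ := Metric.isOpen_iff.1 (isOpen_cuspBall hu) y' (cstar hu hy hl0 hl1)
  set d := min e (r / 2) with hd
  have hdpos : 0 < d := lt_min he (half_pos hr)
  have hbr : ball y' d ⊆ ball y r := by
    intro q hq
    rw [mem_ball] at *
    have := dist_triangle q y' y
    have : d ≤ r / 2 := min_le_right _ _
    linarith
  have hsm : ∀ q ∈ ball y d, (1 - l) • ctr m + l • q ∈ ball y' d := by
    intro q hq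
    rw [mem_ball, dist_eq_norm] at *
    have : (1 - l) • ctr m + l • q - y' = l • (q - y) := by rw [hy', smul_sub]; abel
    rw [this, norm_smul, Real.norm_of_nonneg hl0]
    nlinarith [norm_nonneg (q - y)]
  have hseg : ∀ q ∈ cuspBall (m + 1) u ∩ ball y d,
      segment ℝ q ((1 - l) • ctr m + l • q) ⊆ cuspBall (m + 1) u ∩ ball y r := by
    rintro q hq
    refine subset_inter ?_ ?_
    · rintro z ⟨a, b, ha, hb, hab, rfl⟩
      rcases eq_or_lt_of_le hb with hb0 | hb0
      · have : a = 1 := by linarith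
        rw [← hb0, this]; simpa using hq.1
      · have e1 : a • q + b • ((1 - l) • ctr m + l • q)
            = (1 - (a + b * l)) • ctr m + (a + b * l) • q := by
          have : a = 1 - b := by linarith
          subst this
          module
        rw [e1]
        refine cstar hu (cuspBall_subset_cuspD hq.1) (by positivity) ?_
        nlinarith
    · refine (convex_ball y r).segment_subset ?_ (hbr (hsm _ hq.2))
      exact ball_subset_ball ((min_le_right _ _).trans (by linarith)) hq.2
  refine ⟨ball y' d ∪ ⋃ q ∈ cuspBall (m + 1) u ∩ ball y d,
    segment ℝ q ((1 - l) • ctr m + l • q), ?_, ?_, d, hdpos, ?_⟩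
  · refine isPreconnected_of_forall y' fun z hz => ?_
    rcases hz with hz | hz
    · exact ⟨ball y' d, subset_union_left, mem_ball_self hdpos, hz,
        (convex_ball y' d).isPreconnected⟩
    · obtain ⟨q, hq, hz⟩ := mem_iUnion₂.1 hz
      refine ⟨ball y' d ∪ segment ℝ q ((1 - l) • ctr m + l • q),
        union_subset_union_right _ (subset_biUnion_of_mem (u := fun q =>
          segment ℝ q ((1 - l) • ctr m + l • q)) hq), Or.inl (mem_ball_self hdpos),
        Or.inr hz, ?_⟩
      exact (convex_ball y' d).isPreconnected.union _ (hsm q hq.2) (right_mem_segment _ _ _)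
        (convex_segment _ _).isPreconnected
  · refine union_subset ?_ (iUnion₂_subset hseg)
    exact subset_inter ((ball_subset_ball (min_le_left _ _)).trans heb) hbr
  · intro q hq
    exact Or.inr (mem_iUnion₂.2 ⟨q, hq, left_mem_segment _ _ _⟩)


/-! ### Topology of the extension -/

/-- The topological data of the problem. -/
structure ExtData (m : ℕ) (u : ℝ → ℝ) (h f H : Euc (m + 1) → Euc (m + 1)) : Prop where
  hu : IsModelCusp u
  hhf : IsHomeoOn h f (unitBall (m + 1)) (cuspBall (m + 1) u)
  hHc : ContinuousOn H (closedBall 0 1)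
  hHmaps : Set.MapsTo H (closedBall 0 1) (cuspD m u)
  hHeq : Set.EqOn H h (unitBall (m + 1))

namespace ExtData
variable {m : ℕ} {u : ℝ → ℝ} {h f H : Euc (m + 1) → Euc (m + 1)}

lemma H_mem (E : ExtData m u h f H) {x : Euc (m + 1)} (hx : x ∈ unitBall (m + 1)) :
    H x ∈ cuspBall (m + 1) u := by
  rw [E.hHeq hx]; exact E.hhf.mapsTo hx

lemma H_f (E : ExtData m u h f H) {y : Euc (m + 1)} (hy : y ∈ cuspBall (m + 1) u) :
    H (f y) = y := by
  rw [E.hHeq (E.hhf.mapsTo_inv hy)]; exact E.hhf.right_inv y hy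

lemma ball_sub : unitBall (m + 1) ⊆ closedBall (0 : Euc (m + 1)) 1 := ball_subset_closedBall

/-- Points near `x` in the open ball. -/
lemma mem_clos {x : Euc (m + 1)} (hx : x ∈ closedBall (0 : Euc (m + 1)) 1) :
    (nhdsWithin x (unitBall (m + 1))).NeBot := by
  apply mem_closure_iff_nhdsWithin_neBot.1
  rw [unitBall, closure_ball _ one_ne_zero]; exact hx

lemma tendsto_H (E : ExtData m u h f H) {x : Euc (m + 1)}
    (hx : x ∈ closedBall (0 : Euc (m + 1)) 1) :
    Filter.Tendsto H (nhdsWithin x (unitBall (m + 1))) (nhds (H x)) :=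
  (E.hHc x hx).mono_left (nhdsWithin_mono _ ball_sub)

lemma mem_ball_of (E : ExtData m u h f H) {x : Euc (m + 1)}
    (hx : x ∈ closedBall (0 : Euc (m + 1)) 1) (hy : H x ∈ cuspBall (m + 1) u) :
    x ∈ unitBall (m + 1) := by
  have := mem_clos hx
  have h1 := E.tendsto_H hx
  have h2 : Filter.Tendsto (fun z => f (H z)) (nhdsWithin x (unitBall (m + 1)))
      (nhds (f (H x))) :=
    Filter.Tendsto.comp
      (E.hhf.continuousOn_inv.continuousAt ((isOpen_cuspBall E.hu).mem_nhds hy)) h1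
  have h3 : Filter.Tendsto (fun z => f (H z)) (nhdsWithin x (unitBall (m + 1))) (nhds x) := by
    have : Filter.Tendsto (fun z => z) (nhdsWithin x (unitBall (m + 1))) (nhds x) :=
      nhdsWithin_le_nhds
    refine this.congr' ?_
    filter_upwards [self_mem_nhdsWithin] with z hz
    rw [E.hHeq hz, E.hhf.left_inv z hz]
  rw [← tendsto_nhds_unique h2 h3]
  exact E.hhf.mapsTo_inv hy

lemma surj (E : ExtData m u h f H) {y : Euc (m + 1)} (hy : y ∈ cuspD m u) :
    ∃ x ∈ closedBall (0 : Euc (m + 1)) 1, H x = y := by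
  have hc : IsClosed (H '' closedBall 0 1) :=
    ((isCompact_closedBall _ _).image_of_continuousOn E.hHc).isClosed
  rw [← closure_cuspBall E.hu] at hy
  have : closure (cuspBall (m + 1) u) ⊆ H '' closedBall 0 1 := by
    refine closure_minimal ?_ hc
    intro z hz
    exact ⟨f z, ball_sub (E.hhf.mapsTo_inv hz), E.H_f hz⟩
  exact this hy

lemma closed_preimage (E : ExtData m u h f H) {K : Set (Euc (m + 1))} (hK : IsClosed K) :
    IsCompact (closedBall 0 1 ∩ H ⁻¹' K) :=
  (isCompact_closedBall _ _).of_isClosed_subset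
    (E.hHc.preimage_isClosed_of_isClosed isClosed_closedBall hK) inter_subset_left

lemma fiber_conn (E : ExtData m u h f H) {y : Euc (m + 1)} (hy : y ∈ cuspD m u) :
    IsPreconnected (closedBall 0 1 ∩ H ⁻¹' {y}) := by
  rw [isPreconnected_iff_subset_of_fully_disjoint_closed
    (E.closed_preimage isClosed_singleton).isClosed]
  intro A B hA hB hAB hd
  by_contra hcon
  push Not at hcon
  obtain ⟨⟨b, hb, hbA⟩, ⟨a, ha, haB⟩⟩ := And.imp not_subset.1 not_subset.1 hcon
  replace hbA := (hAB hb).resolve_left hbA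
  replace haB := (hAB ha).resolve_right haB
  obtain ⟨O1, O2, hO1, hO2, hAO, hBO, hO⟩ := normal_separation hA hB hd
  have hKc : IsCompact (H '' (closedBall 0 1 ∩ (O1 ∪ O2)ᶜ)) := by
    refine IsCompact.image_of_continuousOn ?_ (E.hHc.mono inter_subset_left)
    exact (isCompact_closedBall _ _).inter_right (hO1.union hO2).isClosed_compl
  have hyK : y ∉ H '' (closedBall 0 1 ∩ (O1 ∪ O2)ᶜ) := by
    rintro ⟨x, ⟨hx, hxO⟩, hxy⟩
    exact hxO ((hAB ⟨hx, hxy⟩).imp (@hAO x) (@hBO x))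
  obtain ⟨r, hr, hrb⟩ := Metric.isOpen_iff.1 hKc.isClosed.isOpen_compl y hyK
  obtain ⟨W, hW, hWs, d, hd0, hdW⟩ := local_conn E.hu hy hr
  have hfW : IsPreconnected (f '' W) :=
    hW.image f (E.hhf.continuousOn_inv.mono fun z hz => (hWs hz).1)
  have hsub : f '' W ⊆ O1 ∪ O2 := by
    rintro _ ⟨z, hz, rfl⟩
    by_contra hcon
    have hzb := (hWs hz).1
    refine hrb (hWs hz).2 ⟨f z, ⟨ball_sub (E.hhf.mapsTo_inv hzb), hcon⟩, E.H_f hzb⟩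
  have key : ∀ c ∈ closedBall (0 : Euc (m + 1)) 1 ∩ H ⁻¹' {y}, ∀ O : Set (Euc (m + 1)),
      IsOpen O → c ∈ O → (f '' W ∩ O).Nonempty := by
    intro c hc O hO hcO
    have := mem_clos hc.1
    have h1 := E.tendsto_H hc.1
    have hcy : H c = y := hc.2
    rw [hcy] at h1
    have h2 := h1.eventually (ball_mem_nhds y hd0)
    have h3 : ∀ᶠ z in nhdsWithin c (unitBall (m + 1)), z ∈ O :=
      nhdsWithin_le_nhds (hO.mem_nhds hcO)
    obtain ⟨z, ⟨hz1, hz2⟩, hz3⟩ := ((h2.and h3).and eventually_mem_nhdsWithin).exists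
    refine ⟨z, ⟨H z, hdW ⟨E.H_mem hz3, hz1⟩, ?_⟩, hz2⟩
    rw [E.hHeq hz3]; exact E.hhf.left_inv z hz3
  obtain ⟨z, _, hz1, hz2⟩ := hfW O1 O2 hO1 hO2 hsub (key a ha O1 hO1 (hAO haB))
    (key b hb O2 hO2 (hBO hbA))
  exact (Set.disjoint_left.1 hO hz1 hz2)

lemma preimage_conn (E : ExtData m u h f H) {S : Set (Euc (m + 1))} (hS : S ⊆ cuspD m u)
    (hc : IsPreconnected S) : IsPreconnected (closedBall 0 1 ∩ H ⁻¹' S) := by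
  intro O1 O2 hO1 hO2 hsub ⟨a, ha, haO⟩ ⟨b, hb, hbO⟩
  by_contra hcon
  have hcl : ∀ O : Set (Euc (m + 1)), IsOpen O → IsOpen (H '' (closedBall 0 1 ∩ Oᶜ))ᶜ := by
    intro O hO
    refine IsClosed.isOpen_compl (self := ?_)
    refine IsCompact.isClosed (IsCompact.image_of_continuousOn ?_ (E.hHc.mono inter_subset_left))
    exact (isCompact_closedBall _ _).inter_right hO.isClosed_compl
  have hfib : ∀ y ∈ S, closedBall 0 1 ∩ H ⁻¹' {y} ⊆ closedBall 0 1 ∩ H ⁻¹' S := by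
    rintro y hy x ⟨hx, hxy⟩
    have hxy' : H x = y := hxy
    exact ⟨hx, by rw [mem_preimage, hxy']; exact hy⟩
  have hone : ∀ P Q : Set (Euc (m + 1)), IsOpen P → IsOpen Q →
      closedBall 0 1 ∩ H ⁻¹' S ⊆ P ∪ Q → ¬ (closedBall 0 1 ∩ H ⁻¹' S ∩ (P ∩ Q)).Nonempty →
      ∀ x ∈ closedBall 0 1 ∩ H ⁻¹' S, x ∈ P → H x ∈ (H '' (closedBall 0 1 ∩ Pᶜ))ᶜ := by
    rintro P Q hP hQ hPQ hne x hx hxP ⟨z, ⟨hz, hzP⟩, hzx⟩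
    have hf := E.fiber_conn (hS hx.2)
    have hzS : z ∈ closedBall 0 1 ∩ H ⁻¹' S := ⟨hz, by rw [mem_preimage, hzx]; exact hx.2⟩
    obtain ⟨w, hw, hwPQ⟩ := hf P Q hP hQ ((hfib _ hx.2).trans hPQ) ⟨x, ⟨hx.1, rfl⟩, hxP⟩
      ⟨z, ⟨hz, hzx⟩, (hPQ hzS).resolve_left hzP⟩
    exact hne ⟨w, hfib _ hx.2 hw, hwPQ⟩
  have h12 := hone O1 O2 hO1 hO2 hsub hcon
  have h21 := hone O2 O1 hO2 hO1 (by rwa [union_comm]) (by rwa [inter_comm O2])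
  obtain ⟨y, hy, hy1, hy2⟩ := hc _ _ (hcl O1 hO1) (hcl O2 hO2) (by
    intro y hy
    obtain ⟨x, hx, rfl⟩ := E.surj (hS hy)
    rcases hsub ⟨hx, hy⟩ with h' | h'
    · exact Or.inl (h12 x ⟨hx, hy⟩ h')
    · exact Or.inr (h21 x ⟨hx, hy⟩ h')) ⟨H a, ha.2, h12 a ha haO⟩ ⟨H b, hb.2, h21 b hb hbO⟩
  obtain ⟨x, hx, rfl⟩ := E.surj (hS hy)
  refine hcon ⟨x, ⟨hx, hy⟩, ?_, ?_⟩
  · by_contra h'; exact hy1 ⟨x, ⟨hx, h'⟩, rfl⟩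
  · by_contra h'; exact hy2 ⟨x, ⟨hx, h'⟩, rfl⟩

/-- Lifting of limits through singleton fibers. -/
lemma lift_closure (E : ExtData m u h f H) {x : Euc (m + 1)}
    (hx : x ∈ closedBall (0 : Euc (m + 1)) 1)
    (hs : ∀ z ∈ closedBall (0 : Euc (m + 1)) 1, H z = H x → z = x)
    {A : Set (Euc (m + 1))} (hA : A ⊆ cuspD m u) (hxA : H x ∈ closure A) :
    x ∈ closure (closedBall 0 1 ∩ H ⁻¹' A) := by
  have hcomp : IsCompact (closure (closedBall 0 1 ∩ H ⁻¹' A)) :=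
    (isCompact_closedBall (0 : Euc (m + 1)) 1).of_isClosed_subset isClosed_closure
      (closure_minimal inter_subset_left isClosed_closedBall)
  have hsub : closure (closedBall 0 1 ∩ H ⁻¹' A) ⊆ closedBall 0 1 :=
    closure_minimal inter_subset_left isClosed_closedBall
  have h1 : IsClosed (H '' closure (closedBall 0 1 ∩ H ⁻¹' A)) :=
    (hcomp.image_of_continuousOn (E.hHc.mono hsub)).isClosed
  have h2 : closure A ⊆ H '' closure (closedBall 0 1 ∩ H ⁻¹' A) := by
    refine closure_minimal ?_ h1
    intro y hy
    obtain ⟨z, hz, rfl⟩ := E.surj (hA hy)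
    exact ⟨z, subset_closure ⟨hz, hy⟩, rfl⟩
  obtain ⟨z, hz, hzx⟩ := h2 hxA
  rw [← hs z (hsub hz) hzx]
  exact hz

end ExtData


/-! ### Pieces of the boundary of the cusp ball -/

lemma exists_dir {m : ℕ} (hm : 2 ≤ m) (x : Euc m) :
    ∃ θ ∈ sphere (0 : Euc m) 1, x = ‖x‖ • θ := by
  by_cases hx : x = 0
  · have : NeZero m := ⟨by omega⟩
    exact ⟨EuclideanSpace.single 0 1, by simp, by simp [hx]⟩
  · have := norm_ne_zero_iff.2 hx
    refine ⟨‖x‖⁻¹ • x, ?_, ?_⟩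
    · simp [norm_smul, this]
    · rw [smul_smul, mul_inv_cancel₀ this, one_smul]

/-- The surface of revolution with profile `g` over `I`. -/
def revol (m : ℕ) (g : ℝ → ℝ) (I : Set ℝ) : Set (Euc (m + 1)) :=
  (fun q : ℝ × Euc m => pt q.1 (g q.1 • q.2)) '' (I ×ˢ sphere (0 : Euc m) 1)

lemma revol_conn {m : ℕ} (hm : 2 ≤ m) {g : ℝ → ℝ} {I : Set ℝ} (hI : I.OrdConnected)
    (hg : ContinuousOn g I) : IsPreconnected (revol m g I) := by
  have hsph : IsPreconnected (sphere (0 : Euc m) 1) := by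
    apply isPreconnected_sphere
    rw [rank_eq_card_basis (EuclideanSpace.basisFun (Fin m) ℝ).toBasis]
    simp only [Fintype.card_fin]
    exact_mod_cast (by omega : 1 < m)
  refine (hI.isPreconnected.prod hsph).image _ ?_
  have hh : ContinuousOn (fun q : ℝ × Euc m => (q.1, g q.1 • q.2))
      (I ×ˢ sphere (0 : Euc m) 1) := by
    have h1 : ContinuousOn (fun q : ℝ × Euc m => g q.1) (I ×ˢ sphere (0 : Euc m) 1) :=
      hg.comp continuousOn_fst (fun q hq => hq.1)
    have h2 : ContinuousOn (fun q : ℝ × Euc m => g q.1 • q.2) (I ×ˢ sphere (0 : Euc m) 1) :=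
      h1.smul (g := fun q : ℝ × Euc m => q.2) continuousOn_snd
    exact continuousOn_fst.prodMk h2
  exact continuous_pt.comp_continuousOn hh

lemma mem_revol {m : ℕ} (hm : 2 ≤ m) {g : ℝ → ℝ} {I : Set ℝ} {y : Euc (m + 1)}
    (hg : ∀ s ∈ I, 0 ≤ g s) : y ∈ revol m g I ↔ y 0 ∈ I ∧ ‖tl y‖ = g (y 0) := by
  constructor
  · rintro ⟨⟨s, θ⟩, ⟨hs, hθ⟩, rfl⟩
    have h1 : ‖θ‖ = 1 := by simpa using hθ
    simp only at hs
    simp [hs, norm_smul, h1, abs_of_nonneg (hg s hs)]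
  · rintro ⟨h1, h2⟩
    obtain ⟨θ, hθ, hx⟩ := exists_dir hm (tl y)
    refine ⟨(y 0, θ), ⟨h1, hθ⟩, ?_⟩
    simp only
    rw [← h2, ← hx, pt_tl]

lemma side_of {m : ℕ} {u : ℝ → ℝ} (hu : IsModelCusp u) {y : Euc (m + 1)} (hy : y ∈ cuspD m u)
    (hy' : y ∉ cuspBall (m + 1) u) (h1 : ‖y‖ < 1) : 0 ≤ y 0 ∧ ‖tl y‖ = u (y 0) := by
  rw [mem_cuspBall] at hy'
  push Not at hy'
  obtain ⟨h2, h3⟩ := hy' h1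
  refine ⟨h2, h3.antisymm ?_⟩
  rcases hy.2 with h4 | h4
  · have : y 0 = 0 := le_antisymm h4 h2
    rw [this, hu.zero]; exact norm_nonneg _
  · exact h4

lemma side_mem {m : ℕ} {u : ℝ → ℝ} {y : Euc (m + 1)} (h0 : 0 ≤ y 0) (h1 : ‖tl y‖ = u (y 0))
    (h2 : ‖y‖ ≤ 1) : y ∈ cuspD m u ∧ y ∉ cuspBall (m + 1) u := by
  refine ⟨⟨h2, Or.inr h1.ge⟩, fun h => ?_⟩
  rw [mem_cuspBall] at h
  rcases h.2 with h | h <;> linarith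

/-- Lower part of the boundary. -/
def lowG (m : ℕ) (u : ℝ → ℝ) (t : ℝ) : Set (Euc (m + 1)) :=
  {y | y ∈ cuspD m u ∧ y ∉ cuspBall (m + 1) u ∧ ‖y‖ < t}

/-- Upper part of the boundary. -/
def upG (m : ℕ) (u : ℝ → ℝ) (t : ℝ) : Set (Euc (m + 1)) :=
  {y | y ∈ cuspD m u ∧ y ∉ cuspBall (m + 1) u ∧ t < ‖y‖}

lemma norm_lt_iff' {m : ℕ} {y : Euc (m + 1)} {t : ℝ} (ht : 0 ≤ t) :
    ‖y‖ < t ↔ y 0 ^ 2 + ‖tl y‖ ^ 2 < t ^ 2 := by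
  rw [← norm_sq_eq, sq_lt_sq₀ (norm_nonneg _) ht]

lemma lt_norm_iff' {m : ℕ} {y : Euc (m + 1)} {t : ℝ} (ht : 0 ≤ t) :
    t < ‖y‖ ↔ t ^ 2 < y 0 ^ 2 + ‖tl y‖ ^ 2 := by
  rw [← norm_sq_eq, sq_lt_sq₀ ht (norm_nonneg _)]

lemma norm_le_iff' {m : ℕ} {y : Euc (m + 1)} {t : ℝ} (ht : 0 ≤ t) :
    ‖y‖ ≤ t ↔ y 0 ^ 2 + ‖tl y‖ ^ 2 ≤ t ^ 2 := by
  rw [← norm_sq_eq, sq_le_sq₀ (norm_nonneg _) ht]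

lemma norm_eq_iff' {m : ℕ} {y : Euc (m + 1)} {t : ℝ} (ht : 0 ≤ t) :
    ‖y‖ = t ↔ y 0 ^ 2 + ‖tl y‖ ^ 2 = t ^ 2 := by
  rw [← norm_sq_eq, sq_eq_sq₀ (norm_nonneg _) ht]

lemma lowG_conn {m : ℕ} (hm : 2 ≤ m) {u : ℝ → ℝ} (hu : IsModelCusp u) {t : ℝ}
    (ht : t ∈ Ioo (0 : ℝ) 1) : IsPreconnected (lowG m u t) := by
  have : lowG m u t = revol m u {s | 0 ≤ s ∧ s ^ 2 + u s ^ 2 < t ^ 2} := by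
    ext y
    rw [mem_revol hm (fun s hs => hu.nonneg hs.1)]
    constructor
    · rintro ⟨h1, h2, h3⟩
      obtain ⟨h4, h5⟩ := side_of hu h1 h2 (h3.trans ht.2)
      refine ⟨⟨h4, ?_⟩, h5⟩
      rw [← h5]; exact (norm_lt_iff' ht.1.le).1 h3
    · rintro ⟨⟨h1, h2⟩, h3⟩
      rw [← h3, ← norm_lt_iff' ht.1.le] at h2
      obtain ⟨h4, h5⟩ := side_mem h1 h3 (h2.trans ht.2).le
      exact ⟨h4, h5, h2⟩
  rw [this]
  refine revol_conn hm ?_ (hu.continuousOn.mono fun s hs => hs.1)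
  refine ⟨?_⟩
  rintro a ⟨ha, ha'⟩ b ⟨hb, hb'⟩ c ⟨hac, hcb⟩
  refine ⟨ha.trans hac, lt_of_le_of_lt ?_ hb'⟩
  have h1 := hu.le (ha.trans hac) hcb
  have h2 := hu.nonneg (ha.trans hac)
  have h3 := ha.trans hac
  gcongr

lemma upG_conn {m : ℕ} (hm : 2 ≤ m) {u : ℝ → ℝ} (hu : IsModelCusp u) {t : ℝ}
    (ht : t ∈ Ioo (0 : ℝ) 1) : IsPreconnected (upG m u t) := by
  have hI2n : ∀ s ∈ {s : ℝ | s ^ 2 ≤ 1 ∧ (s ≤ 0 ∨ u s ≤ Real.sqrt (1 - s ^ 2))},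
    0 ≤ Real.sqrt (1 - s ^ 2) := fun s _ => Real.sqrt_nonneg _
  have hI1n : ∀ s ∈ {s : ℝ | 0 ≤ s ∧ t ^ 2 < s ^ 2 + u s ^ 2 ∧ s ^ 2 + u s ^ 2 ≤ 1},
    0 ≤ u s := fun s hs => hu.nonneg hs.1
  have e : upG m u t = revol m u {s | 0 ≤ s ∧ t ^ 2 < s ^ 2 + u s ^ 2 ∧ s ^ 2 + u s ^ 2 ≤ 1} ∪
      revol m (fun s => Real.sqrt (1 - s ^ 2))
        {s | s ^ 2 ≤ 1 ∧ (s ≤ 0 ∨ u s ≤ Real.sqrt (1 - s ^ 2))} := by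
    ext y
    rw [mem_union, mem_revol hm hI1n, mem_revol hm hI2n]
    constructor
    · rintro ⟨h1, h2, h3⟩
      rcases lt_or_eq_of_le h1.1 with h6 | h6
      · left
        obtain ⟨h4, h5⟩ := side_of hu h1 h2 h6
        have h7 := (norm_le_iff' zero_le_one).1 h6.le
        rw [lt_norm_iff' ht.1.le] at h3
        rw [h5] at h3 h7
        exact ⟨⟨h4, h3, by simpa using h7⟩, h5⟩
      · right
        have h7 := (norm_eq_iff' zero_le_one).1 h6
        have h8 : ‖tl y‖ = Real.sqrt (1 - y 0 ^ 2) := by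
          rw [← Real.sqrt_sq (norm_nonneg (tl y))]; congr 1; linarith
        refine ⟨⟨by nlinarith [sq_nonneg ‖tl y‖], ?_⟩, h8⟩
        rw [← h8]; exact h1.2
    · rintro (⟨⟨h1, h2, h3⟩, h4⟩ | ⟨⟨h1, h2⟩, h3⟩)
      · rw [← h4] at h2 h3
        obtain ⟨h5, h6⟩ := side_mem h1 h4 ((norm_le_iff' zero_le_one).2 (by simpa using h3))
        exact ⟨h5, h6, (lt_norm_iff' ht.1.le).2 h2⟩
      · have h5 : ‖y‖ = 1 := by
          rw [norm_eq_iff' zero_le_one, h3, Real.sq_sqrt (by linarith)]; ring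
        refine ⟨⟨h5.le, ?_⟩, ?_, by rw [h5]; exact ht.2⟩
        · rw [h3]; exact h2
        · rw [mem_cuspBall]; intro h; linarith [h.1]
  obtain ⟨σ, hσ, hσ1⟩ : ∃ σ ∈ Icc (0 : ℝ) 1, σ ^ 2 + u σ ^ 2 = 1 := by
    have hc : ContinuousOn (fun s => s ^ 2 + u s ^ 2) (Icc 0 1) :=
      (continuousOn_id.pow 2).add ((hu.continuousOn.mono fun s hs => hs.1).pow 2)
    have := intermediate_value_Icc zero_le_one hc
    simp only [hu.zero, hu.one] at this
    exact this ⟨by norm_num, by norm_num⟩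
  obtain ⟨θ, hθ, -⟩ := exists_dir hm 0
  have hθ1 : ‖θ‖ = 1 := by simpa using hθ
  have husq : u σ = Real.sqrt (1 - σ ^ 2) := by
    rw [← Real.sqrt_sq (hu.nonneg hσ.1)]; congr 1; linarith
  have hnorm : ‖tl (pt σ (u σ • θ))‖ = u σ := by
    rw [tl_pt, norm_smul, hθ1, Real.norm_of_nonneg (hu.nonneg hσ.1), mul_one]
  rw [e]
  refine IsPreconnected.union (pt σ (u σ • θ)) ?_ ?_ (revol_conn hm ?_ ?_) (revol_conn hm ?_ ?_)
  · rw [mem_revol hm hI1n, pt_zero]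
    refine ⟨⟨hσ.1, ?_, hσ1.le⟩, hnorm⟩
    rw [hσ1]; nlinarith [ht.1, ht.2]
  · rw [mem_revol hm hI2n, pt_zero]
    refine ⟨⟨by nlinarith [hσ.1, hσ.2], Or.inr husq.le⟩, by rw [hnorm, husq]⟩
  · refine ⟨?_⟩
    rintro a ⟨ha, ha', ha''⟩ b ⟨hb, hb', hb''⟩ c ⟨hac, hcb⟩
    have h0 := ha.trans hac
    have h1 := hu.le h0 hcb
    have h2 := hu.nonneg h0
    have h3 := hu.le ha hac
    have h4 := hu.nonneg ha
    refine ⟨h0, lt_of_lt_of_le ha' ?_, le_trans ?_ hb''⟩ <;> gcongr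
  · exact hu.continuousOn.mono fun s hs => hs.1
  · refine ⟨?_⟩
    rintro a ⟨ha, ha'⟩ b ⟨hb, hb'⟩ c ⟨hac, hcb⟩
    have ha1 := abs_le.1 ((sq_le_one_iff_abs_le_one a).1 ha)
    have hb1 := abs_le.1 ((sq_le_one_iff_abs_le_one b).1 hb)
    refine ⟨by nlinarith, ?_⟩
    by_cases hc0 : c ≤ 0
    · exact Or.inl hc0
    right
    push Not at hc0
    calc u c ≤ u b := hu.le hc0.le hcb
      _ ≤ Real.sqrt (1 - b ^ 2) := hb'.resolve_left (by linarith)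
      _ ≤ Real.sqrt (1 - c ^ 2) := by
        apply Real.sqrt_le_sqrt
        nlinarith
  · exact Continuous.continuousOn (by fun_prop)

section closures
variable {m : ℕ} {u : ℝ → ℝ} {t : ℝ} {y : Euc (m + 1)}

lemma side_pos (hu : IsModelCusp u) (ht : 0 < t) (h0 : 0 ≤ y 0)
    (h1 : ‖tl y‖ = u (y 0)) (h2 : ‖y‖ = t) : 0 < y 0 := by
  rcases eq_or_lt_of_le h0 with h | h
  · rw [norm_eq_iff' ht.le, h1, ← h, hu.zero] at h2
    nlinarith
  · exact h

lemma tendsto_prof {g : ℝ → ℝ} {τ : ℝ} {θ : Euc m} {l : Filter ℝ} (hl : l ≤ nhds τ)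
    (hg : ContinuousAt g τ) :
    Filter.Tendsto (fun s => pt s (g s • θ)) l (nhds (pt τ (g τ • θ))) := by
  have h2 : Filter.Tendsto (fun s : ℝ => (s, g s • θ)) l (nhds (τ, g τ • θ)) := by
    have h3 : ContinuousAt (fun s : ℝ => (s, g s • θ)) τ :=
      continuousAt_id.prodMk (hg.smul continuousAt_const)
    exact h3.mono_left hl
  exact (continuous_pt.tendsto (τ, g τ • θ)).comp h2

lemma mem_closure_lowG (hm : 2 ≤ m) (hu : IsModelCusp u) (ht : t ∈ Ioo (0 : ℝ) 1)
    (h0 : 0 ≤ y 0) (h1 : ‖tl y‖ = u (y 0)) (h2 : ‖y‖ = t) : y ∈ closure (lowG m u t) := by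
  have hp := side_pos hu ht.1 h0 h1 h2
  obtain ⟨θ, hθ, hx⟩ := exists_dir hm (tl y)
  have hθ1 : ‖θ‖ = 1 := by simpa using hθ
  have hy : pt (y 0) (u (y 0) • θ) = y := by rw [← h1, ← hx, pt_tl]
  have := tendsto_prof (θ := θ) (l := nhdsWithin (y 0) (Iio (y 0))) nhdsWithin_le_nhds
    (hu.continuousAt hp)
  rw [hy] at this
  refine mem_closure_of_tendsto this ?_
  filter_upwards [self_mem_nhdsWithin, nhdsWithin_le_nhds (Ioi_mem_nhds hp)] with s hs hs0
  have hs0' : 0 < s := hs0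
  have hn : ‖tl (pt s (u s • θ))‖ = u s := by
    rw [tl_pt, norm_smul, hθ1, Real.norm_of_nonneg (hu.nonneg hs0'.le), mul_one]
  have h3 : ‖pt s (u s • θ)‖ < t := by
    rw [norm_lt_iff' ht.1.le, hn, pt_zero]
    rw [norm_eq_iff' ht.1.le, h1] at h2
    rw [← h2]
    have := hu.lt hs0'.le hs
    have := hu.nonneg hs0'.le
    have hs' : s < y 0 := hs
    gcongr
  obtain ⟨h4, h5⟩ := side_mem (y := pt s (u s • θ)) (u := u) (by simpa using hs0'.le)
    (by rw [hn, pt_zero]) (h3.trans ht.2).le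
  exact ⟨h4, h5, h3⟩

lemma mem_closure_upG (hm : 2 ≤ m) (hu : IsModelCusp u) (ht : t ∈ Ioo (0 : ℝ) 1)
    (h0 : 0 ≤ y 0) (h1 : ‖tl y‖ = u (y 0)) (h2 : ‖y‖ = t) : y ∈ closure (upG m u t) := by
  have hp := side_pos hu ht.1 h0 h1 h2
  obtain ⟨θ, hθ, hx⟩ := exists_dir hm (tl y)
  have hθ1 : ‖θ‖ = 1 := by simpa using hθ
  have hy : pt (y 0) (u (y 0) • θ) = y := by rw [← h1, ← hx, pt_tl]
  have := tendsto_prof (θ := θ) (l := nhdsWithin (y 0) (Ioi (y 0))) nhdsWithin_le_nhds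
    (hu.continuousAt hp)
  rw [hy] at this
  refine mem_closure_of_tendsto this ?_
  have hev : ∀ᶠ s in nhdsWithin (y 0) (Ioi (y 0)), ‖pt s (u s • θ)‖ < 1 := by
    refine this.norm.eventually_lt_const ?_
    rw [h2]; exact ht.2
  filter_upwards [self_mem_nhdsWithin, hev] with s hs h3
  have hs' : y 0 < s := hs
  have hs0' : 0 < s := hp.trans hs'
  have hn : ‖tl (pt s (u s • θ))‖ = u s := by
    rw [tl_pt, norm_smul, hθ1, Real.norm_of_nonneg (hu.nonneg hs0'.le), mul_one]
  have h3' : t < ‖pt s (u s • θ)‖ := by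
    rw [lt_norm_iff' ht.1.le, hn, pt_zero]
    rw [norm_eq_iff' ht.1.le, h1] at h2
    rw [← h2]
    have := hu.lt hp.le hs'
    have := hu.nonneg hp.le
    gcongr
  obtain ⟨h4, h5⟩ := side_mem (y := pt s (u s • θ)) (u := u) (by simpa using hs0'.le)
    (by rw [hn, pt_zero]) h3.le
  exact ⟨h4, h5, h3'⟩

lemma mem_closure_cuspS (hm : 2 ≤ m) (hu : IsModelCusp u) (ht : t ∈ Ioo (0 : ℝ) 1)
    (h0 : 0 ≤ y 0) (h1 : ‖tl y‖ = u (y 0)) (h2 : ‖y‖ = t) :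
    y ∈ closure (cuspS (m + 1) u t) := by
  have hp := side_pos hu ht.1 h0 h1 h2
  obtain ⟨θ, hθ, hx⟩ := exists_dir hm (tl y)
  have hθ1 : ‖θ‖ = 1 := by simpa using hθ
  rw [norm_eq_iff' ht.1.le, h1] at h2
  have hsq : Real.sqrt (t ^ 2 - y 0 ^ 2) = u (y 0) := by
    rw [← Real.sqrt_sq (hu.nonneg h0)]; congr 1; linarith
  have hy : pt (y 0) (Real.sqrt (t ^ 2 - y 0 ^ 2) • θ) = y := by
    rw [hsq, ← h1, ← hx, pt_tl]
  have := tendsto_prof (θ := θ) (l := nhdsWithin (y 0) (Iio (y 0))) nhdsWithin_le_nhds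
    (g := fun s => Real.sqrt (t ^ 2 - s ^ 2)) (by fun_prop)
  rw [hy] at this
  refine mem_closure_of_tendsto this ?_
  filter_upwards [self_mem_nhdsWithin, nhdsWithin_le_nhds (Ioi_mem_nhds hp)] with s hs hs0
  have hs0' : 0 < s := hs0
  have hs' : s < y 0 := hs
  have hn : ‖tl (pt s (Real.sqrt (t ^ 2 - s ^ 2) • θ))‖ = Real.sqrt (t ^ 2 - s ^ 2) := by
    rw [tl_pt, norm_smul, hθ1, Real.norm_of_nonneg (Real.sqrt_nonneg _), mul_one]
  have hge : Real.sqrt (t ^ 2 - y 0 ^ 2) ≤ Real.sqrt (t ^ 2 - s ^ 2) := by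
    apply Real.sqrt_le_sqrt; nlinarith
  have h3 : ‖pt s (Real.sqrt (t ^ 2 - s ^ 2) • θ)‖ = t := by
    rw [norm_eq_iff' ht.1.le, hn, pt_zero, Real.sq_sqrt]
    · ring
    · nlinarith [sq_nonneg (u (y 0))]
  refine ⟨mem_cuspBall.2 ⟨by rw [h3]; exact ht.2, Or.inr ?_⟩, h3⟩
  rw [hn, pt_zero]
  calc u s < u (y 0) := hu.lt hs0'.le hs'
    _ ≤ _ := by rw [← hsq]; exact hge

end closures

/-! ### Assembly, given singleton fibers -/

lemma assembly {m : ℕ} (hm : 2 ≤ m) {u : ℝ → ℝ} {h f H : Euc (m + 1) → Euc (m + 1)}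
    (E : ExtData m u h f H) {t : ℝ} (ht : t ∈ Ioo (0 : ℝ) 1)
    (hs : ∀ x ∈ sphere (0 : Euc (m + 1)) 1, ‖H x‖ = t →
      ∀ z ∈ closedBall (0 : Euc (m + 1)) 1, H z = H x → z = x) :
    ∃ U V : Set (Euc (m + 1)),
        U ∪ V = Metric.sphere (0 : Euc (m + 1)) 1 \ cuspC' (m + 1) u h t ∧
        Disjoint U V ∧
        IsConnected U ∧ IsConnected V ∧
        (∃ U₀ : Set (Euc (m + 1)), IsOpen U₀ ∧ U = U₀ ∩ Metric.sphere (0 : Euc (m + 1)) 1) ∧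
        (∃ V₀ : Set (Euc (m + 1)), IsOpen V₀ ∧ V = V₀ ∩ Metric.sphere (0 : Euc (m + 1)) 1) ∧
        closure U \ U = cuspC' (m + 1) u h t ∧
        closure V \ V = cuspC' (m + 1) u h t := by
  have hu := E.hu
  have hsc : ∀ {x : Euc (m + 1)}, x ∈ sphere (0 : Euc (m + 1)) 1 →
    x ∈ closedBall (0 : Euc (m + 1)) 1 := fun hx => sphere_subset_closedBall hx
  have hnot : ∀ x ∈ sphere (0 : Euc (m + 1)) 1, H x ∉ cuspBall (m + 1) u := by
    intro x hx hcon
    have h1 := E.mem_ball_of (hsc hx) hcon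
    rw [unitBall, mem_ball_zero_iff] at h1
    rw [mem_sphere_zero_iff_norm] at hx
    linarith
  have hsph : ∀ x ∈ closedBall (0 : Euc (m + 1)) 1, H x ∉ cuspBall (m + 1) u →
      x ∈ sphere (0 : Euc (m + 1)) 1 := by
    intro x hx hcon
    rw [mem_closedBall_zero_iff] at hx
    rw [mem_sphere_zero_iff_norm]
    refine hx.antisymm (not_lt.1 fun hlt => hcon (E.H_mem ?_))
    rw [unitBall, mem_ball_zero_iff]; exact hlt
  have hside : ∀ x ∈ sphere (0 : Euc (m + 1)) 1, ‖H x‖ = t →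
      0 ≤ H x 0 ∧ ‖tl (H x)‖ = u (H x 0) := fun x hx hxt =>
    side_of hu (E.hHmaps (hsc hx)) (hnot x hx) (by rw [hxt]; exact ht.2)
  -- identification of the pieces
  have hUeq : closedBall 0 1 ∩ H ⁻¹' lowG m u t = {x ∈ sphere 0 1 | ‖H x‖ < t} := by
    ext x
    constructor
    · rintro ⟨h1, h2, h3, h4⟩
      exact ⟨hsph x h1 h3, h4⟩
    · rintro ⟨h1, h2⟩
      exact ⟨hsc h1, E.hHmaps (hsc h1), hnot x h1, h2⟩
  have hVeq : closedBall 0 1 ∩ H ⁻¹' upG m u t = {x ∈ sphere 0 1 | t < ‖H x‖} := by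
    ext x
    constructor
    · rintro ⟨h1, h2, h3, h4⟩
      exact ⟨hsph x h1 h3, h4⟩
    · rintro ⟨h1, h2⟩
      exact ⟨hsc h1, E.hHmaps (hsc h1), hnot x h1, h2⟩
  have hclosed : ∀ K : Set (Euc (m + 1)), IsClosed K → ∀ A : Set (Euc (m + 1)),
      A ⊆ closedBall 0 1 → (∀ x ∈ A, H x ∈ K) → ∀ x ∈ closure A, H x ∈ K := by
    intro K hK A hA hAK x hx
    have := closure_minimal (t := closedBall 0 1 ∩ H ⁻¹' K) (fun z hz => ⟨hA hz, hAK z hz⟩)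
      (E.closed_preimage hK).isClosed hx
    exact this.2
  have hC : cuspC' (m + 1) u h t = {x ∈ sphere 0 1 | ‖H x‖ = t} := by
    ext x
    constructor
    · rintro ⟨h1, h2⟩
      refine ⟨h2, ?_⟩
      have := hclosed (sphere 0 t) isClosed_sphere _ (fun z hz => ExtData.ball_sub hz.1) (by
        rintro z ⟨hz1, hz2⟩
        rw [E.hHeq hz1, mem_sphere_zero_iff_norm]
        exact hz2.2) x h1
      simpa using this
    · rintro ⟨h1, h2⟩
      refine ⟨?_, h1⟩
      obtain ⟨h3, h4⟩ := hside x h1 h2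
      have := E.lift_closure (hsc h1) (hs x h1 h2) (A := cuspS (m + 1) u t)
        (fun z hz => cuspBall_subset_cuspD hz.1) (mem_closure_cuspS hm hu ht h3 h4 h2)
      refine closure_mono ?_ this
      rintro z ⟨hz1, hz2⟩
      have hzb := E.mem_ball_of hz1 hz2.1
      refine ⟨hzb, ?_⟩
      rw [← E.hHeq hzb]; exact hz2
  have hlow : IsPreconnected {x ∈ sphere (0 : Euc (m + 1)) 1 | ‖H x‖ < t} := by
    rw [← hUeq]; exact E.preimage_conn (fun y hy => hy.1) (lowG_conn hm hu ht)
  have hup : IsPreconnected {x ∈ sphere (0 : Euc (m + 1)) 1 | t < ‖H x‖} := by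
    rw [← hVeq]; exact E.preimage_conn (fun y hy => hy.1) (upG_conn hm hu ht)
  have hUcl : ∀ x ∈ sphere (0 : Euc (m + 1)) 1, ‖H x‖ = t →
      x ∈ closure {x ∈ sphere (0 : Euc (m + 1)) 1 | ‖H x‖ < t} := by
    intro x h1 h2
    obtain ⟨h3, h4⟩ := hside x h1 h2
    rw [← hUeq]
    exact E.lift_closure (hsc h1) (hs x h1 h2) (fun z hz => hz.1)
      (mem_closure_lowG hm hu ht h3 h4 h2)
  have hVcl : ∀ x ∈ sphere (0 : Euc (m + 1)) 1, ‖H x‖ = t →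
      x ∈ closure {x ∈ sphere (0 : Euc (m + 1)) 1 | t < ‖H x‖} := by
    intro x h1 h2
    obtain ⟨h3, h4⟩ := hside x h1 h2
    rw [← hVeq]
    exact E.lift_closure (hsc h1) (hs x h1 h2) (fun z hz => hz.1)
      (mem_closure_upG hm hu ht h3 h4 h2)
  -- a boundary point with norm exactly `t`
  obtain ⟨x₀, hx₀, hx₀t⟩ : ∃ x ∈ sphere (0 : Euc (m + 1)) 1, ‖H x‖ = t := by
    obtain ⟨σ, hσ, hσ1⟩ : ∃ σ ∈ Icc (0 : ℝ) 1, σ ^ 2 + u σ ^ 2 = t ^ 2 := by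
      have hc : ContinuousOn (fun s => s ^ 2 + u s ^ 2) (Icc 0 1) :=
        (continuousOn_id.pow 2).add ((hu.continuousOn.mono fun s hs => hs.1).pow 2)
      have := intermediate_value_Icc zero_le_one hc
      simp only [hu.zero, hu.one] at this
      exact this ⟨by nlinarith [ht.1], by nlinarith [ht.1, ht.2]⟩
    obtain ⟨θ, hθ, -⟩ := exists_dir hm 0
    have hθ1 : ‖θ‖ = 1 := by simpa using hθ
    have hnorm : ‖tl (pt σ (u σ • θ))‖ = u σ := by
      rw [tl_pt, norm_smul, hθ1, Real.norm_of_nonneg (hu.nonneg hσ.1), mul_one]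
    have hnt : ‖pt σ (u σ • θ)‖ = t := by
      rw [norm_eq_iff' ht.1.le, hnorm, pt_zero, hσ1]
    obtain ⟨h4, h5⟩ := side_mem (y := pt σ (u σ • θ)) (u := u) (by simpa using hσ.1)
      (by rw [hnorm, pt_zero]) (by rw [hnt]; exact ht.2.le)
    obtain ⟨x, hx, hxy⟩ := E.surj h4
    exact ⟨x, hsph x hx (by rw [hxy]; exact h5), by rw [hxy, hnt]⟩
  have hrel : ∀ O : Set (Euc (m + 1)), IsOpen O → ∃ U₀ : Set (Euc (m + 1)), IsOpen U₀ ∧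
      {x ∈ sphere (0 : Euc (m + 1)) 1 | H x ∈ O} = U₀ ∩ sphere 0 1 := by
    intro O hO
    obtain ⟨U₀, h1, h2⟩ := continuousOn_iff'.1 E.hHc O hO
    refine ⟨U₀, h1, ?_⟩
    ext x
    constructor
    · rintro ⟨hx, hxO⟩
      have : x ∈ H ⁻¹' O ∩ closedBall 0 1 := ⟨hxO, hsc hx⟩
      rw [h2] at this
      exact ⟨this.1, hx⟩
    · rintro ⟨hx, hxs⟩
      have : x ∈ U₀ ∩ closedBall 0 1 := ⟨hx, hsc hxs⟩
      rw [← h2] at this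
      exact ⟨hxs, this.1⟩
  have hcls : ∀ A : Set (Euc (m + 1)), A ⊆ sphere 0 1 → closure A ⊆ sphere 0 1 := fun A hA =>
    closure_minimal hA isClosed_sphere
  refine ⟨{x ∈ sphere 0 1 | ‖H x‖ < t}, {x ∈ sphere 0 1 | t < ‖H x‖}, ?_, ?_,
    ⟨closure_nonempty_iff.1 ⟨x₀, hUcl x₀ hx₀ hx₀t⟩, hlow⟩,
    ⟨closure_nonempty_iff.1 ⟨x₀, hVcl x₀ hx₀ hx₀t⟩, hup⟩, ?_, ?_, ?_, ?_⟩
  · rw [hC]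
    ext x
    constructor
    · rintro (⟨h1, h2⟩ | ⟨h1, h2⟩)
      · exact ⟨h1, fun h3 => h2.ne h3.2⟩
      · exact ⟨h1, fun h3 => h2.ne' h3.2⟩
    · rintro ⟨h1, h2⟩
      rcases lt_trichotomy ‖H x‖ t with h3 | h3 | h3
      · exact Or.inl ⟨h1, h3⟩
      · exact absurd ⟨h1, h3⟩ h2
      · exact Or.inr ⟨h1, h3⟩
  · rw [Set.disjoint_left]
    rintro x ⟨_, h1⟩ ⟨_, h2⟩
    exact lt_asymm h1 h2
  · exact hrel {y | ‖y‖ < t} (isOpen_lt continuous_norm continuous_const)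
  · exact hrel {y | t < ‖y‖} (isOpen_lt continuous_const continuous_norm)
  · rw [hC]
    ext x
    constructor
    · rintro ⟨h1, h2⟩
      have h3 := hcls _ (fun z hz => hz.1) h1
      have h4 : ‖H x‖ ≤ t := hclosed {y | ‖y‖ ≤ t} (isClosed_le continuous_norm continuous_const)
        _ (fun z hz => hsc hz.1) (fun z hz => le_of_lt hz.2) x h1
      exact ⟨h3, h4.antisymm (not_lt.1 fun h5 => h2 ⟨h3, h5⟩)⟩
    · rintro ⟨h1, h2⟩
      exact ⟨hUcl x h1 h2, fun h3 => h3.2.ne h2⟩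
  · rw [hC]
    ext x
    constructor
    · rintro ⟨h1, h2⟩
      have h3 := hcls _ (fun z hz => hz.1) h1
      have h4 : t ≤ ‖H x‖ := hclosed {y | t ≤ ‖y‖} (isClosed_le continuous_const continuous_norm)
        _ (fun z hz => hsc hz.1) (fun z hz => le_of_lt hz.2) x h1
      exact ⟨h3, h4.antisymm' (not_lt.1 fun h5 => h2 ⟨h3, h5⟩)⟩
    · rintro ⟨h1, h2⟩
      exact ⟨hVcl x h1 h2, fun h3 => h3.2.ne' h2⟩


/-! ### Analysis: slices and the Morrey estimate -/

lemma measurePreserving_pt {m : ℕ} :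
    MeasurePreserving (fun q : ℝ × Euc m => pt q.1 q.2)
      ((volume : Measure ℝ).prod (volume : Measure (Euc m))) volume := by
  have h1 : MeasurePreserving (fun q : ℝ × Euc m => (q.1, WithLp.ofLp q.2))
      ((volume : Measure ℝ).prod (volume : Measure (Euc m)))
      ((volume : Measure ℝ).prod (volume : Measure (Fin m → ℝ))) :=
    (MeasurePreserving.id _).prod (PiLp.volume_preserving_ofLp (Fin m))
  have h2 := (volume_preserving_piFinSuccAbove (fun _ : Fin (m + 1) => ℝ) 0).symm
  have h3 := PiLp.volume_preserving_toLp (Fin (m + 1))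
  have h4 := h3.comp (h2.comp h1)
  have h5 : (fun q : ℝ × Euc m => pt q.1 q.2) = WithLp.toLp 2 ∘
      ⇑(MeasurableEquiv.piFinSuccAbove (fun _ : Fin (m + 1) => ℝ) 0).symm ∘
        fun q : ℝ × Euc m => (q.1, q.2.ofLp) := by
    funext q
    refine euc_ext ?_ ?_
    · simp [MeasurableEquiv.piFinSuccAbove]
    · ext i; simp [MeasurableEquiv.piFinSuccAbove]
  rw [h5]
  exact h4

lemma lintegral_slices {m : ℕ} {Φ : Euc (m + 1) → ℝ≥0∞} (hΦ : Measurable Φ) :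
    ∫⁻ x, Φ x = ∫⁻ s : ℝ, ∫⁻ x : Euc m, Φ (pt s x) := by
  rw [← measurePreserving_pt.map_eq, lintegral_map hΦ continuous_pt.measurable,
    lintegral_prod]
  exact (hΦ.comp continuous_pt.measurable).aemeasurable

lemma lintegral_affine {m : ℕ} {Q : Euc m → ℝ≥0∞} (hQ : Measurable Q) (z : Euc m) {l : ℝ}
    (hl : 0 < l) :
    ∫⁻ e, Q (z + l • (e - z)) = ENNReal.ofReal ((l ^ m)⁻¹) * ∫⁻ e, Q e := by
  rw [lintegral_sub_right_eq_self (μ := volume) (fun e : Euc m => Q (z + l • e)) z]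
  have h1 : ∫⁻ e, Q (z + l • e) = ∫⁻ e, Q (z + e) ∂(Measure.map (l • ·) volume) := by
    rw [lintegral_map]
    · exact hQ.comp (measurable_const_add z)
    · exact measurable_const_smul l
  rw [h1, Measure.map_addHaar_smul _ hl.ne', lintegral_smul_measure,
    lintegral_add_left_eq_self (μ := volume) Q z]
  simp [abs_of_pos (pow_pos hl m)]

lemma morrey_half {m : ℕ} {p : ℝ} (hp1 : 1 < p) {Q : Euc m → ℝ≥0∞} (hQ : Measurable Q)
    (z : Euc m) {E : Set (Euc m)} (hE : MeasurableSet E) (G : Euc m → ℝ≥0∞) (R : ℝ≥0∞)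
    (hG : ∀ e ∈ E, G e ≤ ∫⁻ l in Ioo (0 : ℝ) 1, R * Q (z + l • (e - z))) :
    ∫⁻ e in E, G e ≤ R * ((∫⁻ l in Ioo (0 : ℝ) 1, ENNReal.ofReal ((l ^ m)⁻¹) ^ (1 / p)) *
      ((volume E) ^ (1 - 1 / p) * (∫⁻ e, Q e ^ p) ^ (1 / p))) := by
  have hp0 : 0 < p := by linarith
  have hmeas : Measurable (fun q : Euc m × ℝ => Q (z + q.2 • (q.1 - z))) :=
    hQ.comp (by fun_prop)
  calc ∫⁻ e in E, G e ≤ ∫⁻ e in E, ∫⁻ l in Ioo (0 : ℝ) 1, R * Q (z + l • (e - z)) :=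
        setLIntegral_mono' hE hG
    _ = ∫⁻ l in Ioo (0 : ℝ) 1, ∫⁻ e in E, R * Q (z + l • (e - z)) := by
        rw [lintegral_lintegral_swap]
        exact (measurable_const.mul hmeas).aemeasurable
    _ = R * ∫⁻ l in Ioo (0 : ℝ) 1, ∫⁻ e in E, Q (z + l • (e - z)) := by
        rw [← lintegral_const_mul]
        · refine lintegral_congr fun l => ?_
          rw [lintegral_const_mul]
          exact hQ.comp (by fun_prop)
        · exact Measurable.lintegral_prod_right' (f := fun q : ℝ × Euc m =>
            Q (z + q.1 • (q.2 - z))) (hQ.comp (by fun_prop))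
    _ ≤ R * ∫⁻ l in Ioo (0 : ℝ) 1, ENNReal.ofReal ((l ^ m)⁻¹) ^ (1 / p) *
          ((volume E) ^ (1 - 1 / p) * (∫⁻ e, Q e ^ p) ^ (1 / p)) := by
        gcongr 1
        refine setLIntegral_mono' measurableSet_Ioo fun l hl => ?_
        have hq : p.HolderConjugate (p / (p - 1)) := Real.HolderConjugate.conjExponent hp1
        have h1 := ENNReal.lintegral_mul_le_Lp_mul_Lq (volume.restrict E) hq
          (f := fun e => Q (z + l • (e - z))) (g := fun _ => 1)
          (hQ.comp (by fun_prop)).aemeasurable aemeasurable_const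
        have h2 : ∫⁻ e in E, Q (z + l • (e - z)) ^ p ≤
            ENNReal.ofReal ((l ^ m)⁻¹) * ∫⁻ e, Q e ^ p := by
          rw [← lintegral_affine (hQ.pow_const p) z hl.1]
          exact setLIntegral_le_lintegral _ _
        have h3 : 1 / (p / (p - 1)) = 1 - 1 / p := by
          field_simp
        simp only [Pi.mul_apply, mul_one, ENNReal.one_rpow, lintegral_const,
          Measure.restrict_apply, MeasurableSet.univ, univ_inter, one_mul, h3] at h1
        refine h1.trans ?_
        calc (∫⁻ e in E, Q (z + l • (e - z)) ^ p) ^ (1 / p) * volume E ^ (1 - 1 / p)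
            ≤ (ENNReal.ofReal ((l ^ m)⁻¹) * ∫⁻ e, Q e ^ p) ^ (1 / p) *
              volume E ^ (1 - 1 / p) := by gcongr
          _ = _ := by
              rw [ENNReal.mul_rpow_of_nonneg _ _ (by positivity)]; ring
    _ = _ := by
        rw [lintegral_mul_const]
        exact ((by fun_prop : Measurable fun l : ℝ => ((l ^ m)⁻¹)).ennreal_ofReal).pow_const _

lemma J_ne_top {m : ℕ} {p : ℝ} (hp : (m : ℝ) < p) :
    ∫⁻ l in Ioo (0 : ℝ) 1, ENNReal.ofReal ((l ^ m)⁻¹) ^ (1 / p) ≠ ⊤ := by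
  have hp0 : 0 < p := lt_of_le_of_lt (Nat.cast_nonneg m) hp
  have h1 : IntegrableOn (fun l : ℝ => l ^ (-(m / p) : ℝ)) (Ioo 0 1) := by
    rw [intervalIntegral.integrableOn_Ioo_rpow_iff one_pos]
    have : (m : ℝ) / p < 1 := by rw [div_lt_one hp0]; exact hp
    linarith
  have h2 : ∫⁻ l in Ioo (0 : ℝ) 1, ENNReal.ofReal ((l ^ m)⁻¹) ^ (1 / p) =
      ∫⁻ l in Ioo (0 : ℝ) 1, ENNReal.ofReal (l ^ (-(m / p) : ℝ)) := by
    refine setLIntegral_congr_fun measurableSet_Ioo fun l hl => ?_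
    have hl0 : (0 : ℝ) < l := hl.1
    rw [ENNReal.ofReal_rpow_of_nonneg (by positivity) (by positivity)]
    congr 1
    rw [← Real.rpow_natCast, ← Real.rpow_neg hl0.le, ← Real.rpow_mul hl0.le]
    congr 1; ring
  rw [h2]
  exact h1.lintegral_lt_top.ne


/-! ### Mollification -/
open scoped Convolution

section mollify
variable {n : ℕ}

/-- Extension by zero of the `i`-th component. -/
def zext (Ω : Set (Euc n)) (f : Euc n → Euc n) (i : Fin n) : Euc n → ℝ :=
  Ω.indicator (fun x => f x i)

/-- Mollified component. -/
def mol (Ω : Set (Euc n)) (f : Euc n → Euc n) (φ : ContDiffBump (0 : Euc n)) (i : Fin n) :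
    Euc n → ℝ :=
  (φ.normed volume) ⋆[ContinuousLinearMap.lsmul ℝ ℝ, volume] (zext Ω f i)

/-- Mollified bound. -/
def molA (Ψ : Euc n → ℝ≥0∞) (φ : ContDiffBump (0 : Euc n)) (x : Euc n) : ℝ≥0∞ :=
  ∫⁻ y, Ψ y * ‖φ.normed volume (x - y)‖ₑ

lemma measurable_molA {Ψ : Euc n → ℝ≥0∞} (hΨ : Measurable Ψ) (φ : ContDiffBump (0 : Euc n)) :
    Measurable (molA Ψ φ) := by
  refine Measurable.lintegral_prod_right' (f := fun q : Euc n × Euc n =>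
    Ψ q.2 * ‖φ.normed volume (q.1 - q.2)‖ₑ) ?_
  refine (hΨ.comp measurable_snd).mul ?_
  have : Continuous (fun q : Euc n × Euc n => φ.normed volume (q.1 - q.2)) :=
    φ.continuous_normed.comp (by fun_prop)
  exact this.measurable.enorm

lemma lintegral_normed (φ : ContDiffBump (0 : Euc n)) :
    ∫⁻ y, ‖φ.normed volume y‖ₑ = 1 := by
  have h1 := ofReal_integral_eq_lintegral_ofReal (φ.integrable_normed (μ := volume))
    (Filter.Eventually.of_forall φ.nonneg_normed)
  rw [φ.integral_normed] at h1
  rw [← ENNReal.ofReal_one, h1]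
  refine lintegral_congr fun y => ?_
  rw [Real.enorm_eq_ofReal (φ.nonneg_normed y)]

lemma molA_rpow_le {p : ℝ} (hp1 : 1 < p) {Ψ : Euc n → ℝ≥0∞} (hΨ : Measurable Ψ)
    (φ : ContDiffBump (0 : Euc n)) (x : Euc n) :
    molA Ψ φ x ^ p ≤ ∫⁻ y, Ψ y ^ p * ‖φ.normed volume (x - y)‖ₑ := by
  have hp0 : 0 < p := by linarith
  set w : Euc n → ℝ≥0∞ := fun y => ‖φ.normed volume (x - y)‖ₑ with hw
  have hwm : Measurable w := by
    have : Continuous (fun q : Euc n => φ.normed volume (x - q)) :=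
      φ.continuous_normed.comp (by fun_prop)
    exact this.measurable.enorm
  have hw1 : ∫⁻ y, w y = 1 := by
    rw [hw, lintegral_sub_left_eq_self (μ := volume) (fun y => ‖φ.normed volume y‖ₑ) x]
    exact lintegral_normed φ
  have hq : p.HolderConjugate (p / (p - 1)) := Real.HolderConjugate.conjExponent hp1
  have hq0 : 0 < p / (p - 1) := hq.symm.pos
  have h1 := ENNReal.lintegral_mul_le_Lp_mul_Lq volume hq
    (f := fun y => Ψ y * w y ^ (1 / p)) (g := fun y => w y ^ (1 / (p / (p - 1))))
    (hΨ.mul (hwm.pow_const _)).aemeasurable (hwm.pow_const _).aemeasurable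
  have e1 : ∀ y, (Ψ y * w y ^ (1 / p)) * w y ^ (1 / (p / (p - 1))) = Ψ y * w y := by
    intro y
    rw [mul_assoc, ← ENNReal.rpow_add_of_nonneg _ _ (by positivity) (by positivity)]
    have : 1 / p + 1 / (p / (p - 1)) = 1 := by
      have := hq.inv_add_inv_eq_one; simpa [one_div] using this
    rw [this, ENNReal.rpow_one]
  have e2 : ∀ y, (Ψ y * w y ^ (1 / p)) ^ p = Ψ y ^ p * w y := by
    intro y
    rw [ENNReal.mul_rpow_of_nonneg _ _ hp0.le, ← ENNReal.rpow_mul, one_div_mul_cancel hp0.ne',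
      ENNReal.rpow_one]
  have e3 : ∀ y, (w y ^ (1 / (p / (p - 1)))) ^ (p / (p - 1)) = w y := by
    intro y
    rw [← ENNReal.rpow_mul, one_div_mul_cancel hq0.ne', ENNReal.rpow_one]
  simp only [Pi.mul_apply, e1, e2, e3, hw1, ENNReal.one_rpow, mul_one] at h1
  calc molA Ψ φ x ^ p ≤ ((∫⁻ y, Ψ y ^ p * w y) ^ (1 / p)) ^ p := by
        gcongr; exact h1
    _ = _ := by rw [← ENNReal.rpow_mul, one_div_mul_cancel hp0.ne', ENNReal.rpow_one]

lemma lintegral_swap_conv {Φ w : Euc n → ℝ≥0∞} (hΦ : Measurable Φ) (hw : Measurable w)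
    (hw1 : ∫⁻ x, w x = 1) : ∫⁻ x, ∫⁻ y, Φ y * w (x - y) = ∫⁻ y, Φ y := by
  have hm : Measurable (fun q : Euc n × Euc n => Φ q.2 * w (q.1 - q.2)) :=
    (hΦ.comp measurable_snd).mul (hw.comp (by fun_prop))
  rw [lintegral_lintegral_swap hm.aemeasurable]
  refine lintegral_congr fun y => ?_
  have hm2 : Measurable (fun x : Euc n => w (x - y)) := hw.comp (by fun_prop)
  rw [lintegral_const_mul _ hm2, lintegral_sub_right_eq_self (μ := volume) w y, hw1, mul_one]

lemma lintegral_molA_le {p : ℝ} (hp1 : 1 < p) {Ψ : Euc n → ℝ≥0∞} (hΨ : Measurable Ψ)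
    (φ : ContDiffBump (0 : Euc n)) :
    ∫⁻ x, molA Ψ φ x ^ p ≤ ∫⁻ y, Ψ y ^ p := by
  have hw : Measurable (fun x : Euc n => ‖φ.normed volume x‖ₑ) :=
    φ.continuous_normed.measurable.enorm
  rw [← lintegral_swap_conv (hΨ.pow_const p) hw (lintegral_normed φ)]
  exact lintegral_mono fun x => molA_rpow_le hp1 hΨ φ x

lemma integrable_zext {Ω : Set (Euc n)} (hΩ : IsOpen Ω) (hΩb : Ω ⊆ ball 0 1)
    {f : Euc n → Euc n} (hfc : ContinuousOn f Ω) (hfb : ∀ x ∈ Ω, ‖f x‖ ≤ 1) (i : Fin n) :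
    Integrable (zext Ω f i) volume := by
  rw [zext, integrable_indicator_iff hΩ.measurableSet]
  have hfin : volume Ω < ⊤ := (measure_mono hΩb).trans_lt measure_ball_lt_top
  have : IsFiniteMeasure (volume.restrict Ω) := ⟨by simpa using hfin⟩
  refine Integrable.of_bound (C := 1) ?_ ?_
  · refine ContinuousOn.aestronglyMeasurable ?_ hΩ.measurableSet
    exact (by fun_prop : Continuous fun x : Euc n => x i).comp_continuousOn hfc
  · refine (ae_restrict_iff' hΩ.measurableSet).2 (Filter.Eventually.of_forall fun x hx => ?_)
    exact (PiLp.norm_apply_le (f x) i).trans (hfb x hx)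

lemma contDiff_mol {Ω : Set (Euc n)} {f : Euc n → Euc n} {i : Fin n}
    (hI : Integrable (zext Ω f i) volume) (φ : ContDiffBump (0 : Euc n)) :
    ContDiff ℝ 1 (mol Ω f φ i) :=
  φ.hasCompactSupport_normed.contDiff_convolution_left _ (φ.contDiff_normed (n := 1))
    hI.locallyIntegrable

lemma fderiv_mol {Ω : Set (Euc n)} (hΩ : IsOpen Ω) {f : Euc n → Euc n} {i : Fin n}
    (hI : Integrable (zext Ω f i) volume) (φ : ContDiffBump (0 : Euc n)) (x v : Euc n) :
    fderiv ℝ (mol Ω f φ i) x v =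
      ∫ y in Ω, f y i * fderiv ℝ (φ.normed volume) (x - y) v := by
  have h1 := (φ.hasCompactSupport_normed (μ := volume)).hasFDerivAt_convolution_left (μ := volume)
    (ContinuousLinearMap.lsmul ℝ ℝ) (φ.contDiff_normed (n := 1)) hI.locallyIntegrable x
  rw [mol, h1.fderiv, convolution_eq_swap, ContinuousLinearMap.integral_apply]
  · rw [← integral_indicator hΩ.measurableSet]
    refine integral_congr_ae (Filter.Eventually.of_forall fun y => ?_)
    by_cases hy : y ∈ Ω
    · simp [ContinuousLinearMap.precompL_apply, zext, hy, mul_comm]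
    · simp [zext, hy]
  · have h2 := (φ.hasCompactSupport_normed (μ := volume)).fderiv (𝕜 := ℝ)
    have h3 := h2.convolutionExists_left (μ := volume)
      (L := (ContinuousLinearMap.lsmul ℝ ℝ).precompL (Euc n))
      ((φ.contDiff_normed (n := 1)).continuous_fderiv (by norm_num)) hI.locallyIntegrable x
    exact h3.integrable_swap

lemma fderiv_mol_single {p : ℝ} {Ω : Set (Euc n)} (hΩ : IsOpen Ω) {f : Euc n → Euc n}
    {Df : Euc n → Matrix (Fin n) (Fin n) ℝ} (hS : MemSobolev p Ω f Df) {i : Fin n}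
    (hI : Integrable (zext Ω f i) volume) (φ : ContDiffBump (0 : Euc n)) (x : Euc n)
    (hx : closedBall x φ.rOut ⊆ Ω) (j : Fin n) :
    fderiv ℝ (mol Ω f φ i) x (EuclideanSpace.single j 1) =
      ∫ y in Ω, Df y i j * φ.normed volume (x - y) := by
  rw [fderiv_mol hΩ hI]
  have hd : Differentiable ℝ (φ.normed (volume : Measure (Euc n))) :=
    (φ.contDiff_normed (n := 1)).differentiable (by norm_num)
  have ht : tsupport (fun y => φ.normed volume (x - y)) = closedBall x φ.rOut := by
    have := tsupport_comp_eq_preimage (φ.normed (volume : Measure (Euc n)))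
      (Homeomorph.subLeft x)
    have h2 : (φ.normed (volume : Measure (Euc n)) ∘ ⇑(Homeomorph.subLeft x)) =
      fun y => φ.normed volume (x - y) := by funext y; simp
    rw [h2] at this
    rw [this, φ.tsupport_normed_eq]
    ext y; simp [dist_eq_norm, norm_sub_rev]
  have h := hS.parts (fun y => φ.normed volume (x - y))
    ((φ.contDiff_normed (n := ⊤)).comp (by fun_prop)) (by
      rw [HasCompactSupport, ht]; exact isCompact_closedBall _ _) (by rw [ht]; exact hx) i j
  have h3 : ∀ y, fderiv ℝ (fun y => φ.normed volume (x - y)) y (EuclideanSpace.single j 1) =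
      - fderiv ℝ (φ.normed volume) (x - y) (EuclideanSpace.single j 1) := by
    intro y
    have h4 : HasFDerivAt (fun y : Euc n => x - y) (-(ContinuousLinearMap.id ℝ (Euc n))) y := by
      simpa using (hasFDerivAt_id y).const_sub x
    have h5 : HasFDerivAt (fun y => φ.normed volume (x - y)) _ y :=
      (hd (x - y)).hasFDerivAt.comp y h4
    rw [h5.fderiv]
    simp
  simp only [h3, mul_neg, integral_neg] at h
  exact neg_injective h

lemma enorm_fderiv_mol_le {p : ℝ} {Ω : Set (Euc n)} (hΩ : IsOpen Ω) {f : Euc n → Euc n}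
    {Df : Euc n → Matrix (Fin n) (Fin n) ℝ} (hS : MemSobolev p Ω f Df) {i : Fin n}
    (hI : Integrable (zext Ω f i) volume) {Ψ : Euc n → ℝ≥0∞}
    (hΨ : ∀ᵐ y ∂(volume.restrict Ω), ∀ i j, ‖Df y i j‖ₑ ≤ Ψ y)
    (φ : ContDiffBump (0 : Euc n)) (x v : Euc n)
    (hx : closedBall x φ.rOut ⊆ Ω) :
    ‖fderiv ℝ (mol Ω f φ i) x v‖ₑ ≤ n * ‖v‖ₑ * molA Ψ φ x := by
  have hj : ∀ j, ‖fderiv ℝ (mol Ω f φ i) x (EuclideanSpace.single j 1)‖ₑ ≤ molA Ψ φ x := by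
    intro j
    rw [fderiv_mol_single hΩ hS hI φ x hx j]
    calc _ ≤ ∫⁻ y in Ω, ‖Df y i j * φ.normed volume (x - y)‖ₑ := enorm_integral_le_lintegral_enorm _
      _ ≤ ∫⁻ y in Ω, Ψ y * ‖φ.normed volume (x - y)‖ₑ := by
          refine lintegral_mono_ae ?_
          filter_upwards [hΨ] with y hy
          rw [enorm_mul]; gcongr; exact hy i j
      _ ≤ _ := setLIntegral_le_lintegral _ _
  have hv : v = ∑ j, v j • (EuclideanSpace.single j 1 : Euc n) := by
    ext k; simp [Finset.sum_apply, Pi.single_apply]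
  conv_lhs => rw [hv, map_sum]
  calc _ ≤ ∑ j, ‖fderiv ℝ (mol Ω f φ i) x (v j • EuclideanSpace.single j 1)‖ₑ :=
        enorm_sum_le _ _
    _ ≤ ∑ _j : Fin n, ‖v‖ₑ * molA Ψ φ x := by
        refine Finset.sum_le_sum fun j _ => ?_
        rw [map_smul, smul_eq_mul, enorm_mul]
        gcongr
        · rw [← ofReal_norm, ← ofReal_norm]
          exact ENNReal.ofReal_le_ofReal (PiLp.norm_apply_le v j)
        · exact hj j
    _ = _ := by simp [mul_assoc]

lemma tendsto_mol {Ω : Set (Euc n)} (hΩ : IsOpen Ω) {f : Euc n → Euc n}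
    (hfc : ContinuousOn f Ω) {i : Fin n} (hI : Integrable (zext Ω f i) volume)
    {φ : ℕ → ContDiffBump (0 : Euc n)}
    (hφ : Filter.Tendsto (fun k => (φ k).rOut) Filter.atTop (nhds 0)) {x : Euc n} (hx : x ∈ Ω) :
    Filter.Tendsto (fun k => mol Ω f (φ k) i x) Filter.atTop (nhds (f x i)) := by
  refine ContDiffBump.convolution_tendsto_right (g := fun _ => zext Ω f i) hφ
    (Filter.Eventually.of_forall fun _ => hI.1) ?_ tendsto_const_nhds
  have h1 : ContinuousAt (zext Ω f i) x := by
    have h2 : ContinuousAt (fun x => f x i) x :=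
      (by fun_prop : Continuous fun x : Euc n => x i).continuousAt.comp
        (hfc.continuousAt (hΩ.mem_nhds hx))
    refine h2.congr ?_
    filter_upwards [hΩ.mem_nhds hx] with y hy
    simp [zext, hy]
  have h2 : zext Ω f i x = f x i := by simp [zext, hx]
  rw [← h2]
  exact h1.tendsto.comp Filter.tendsto_snd

lemma abs_entry_le (M : Matrix (Fin n) (Fin n) ℝ) (i j : Fin n) : |M i j| ≤ opNorm M := by
  have h1 := (LinearMap.toContinuousLinearMap (Matrix.toEuclideanLin M)).le_opNorm
    (EuclideanSpace.single j (1 : ℝ))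
  have h2 := PiLp.norm_apply_le (LinearMap.toContinuousLinearMap (Matrix.toEuclideanLin M)
    (EuclideanSpace.single j (1 : ℝ))) i
  rw [PiLp.norm_single, norm_one, mul_one] at h1
  refine le_trans (le_of_eq ?_) (h2.trans h1)
  simp [Matrix.toEuclideanLin, Matrix.toLpLin_apply, Matrix.mulVec_single]

lemma exists_Psi {p : ℝ} (hp0 : 0 < p) {Ω : Set (Euc n)} (hΩ : IsOpen Ω) {f : Euc n → Euc n}
    {Df : Euc n → Matrix (Fin n) (Fin n) ℝ} (hS : MemSobolev p Ω f Df) :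
    ∃ Ψ : Euc n → ℝ≥0∞, Measurable Ψ ∧ ∫⁻ y, Ψ y ^ p ≠ ⊤ ∧
      ∀ᵐ y ∂(volume.restrict Ω), ∀ i j, ‖Df y i j‖ₑ ≤ Ψ y := by
  obtain ⟨Θ, hΘm, hΘ⟩ := hS.lp.1
  refine ⟨Ω.indicator fun y => ENNReal.ofReal (Θ y) ^ (1 / p), ?_, ?_, ?_⟩
  · exact (hΘm.measurable.ennreal_ofReal.pow_const _).indicator hΩ.measurableSet
  · have h1 : ∫⁻ y, (Ω.indicator fun y => ENNReal.ofReal (Θ y) ^ (1 / p)) y ^ p =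
        ∫⁻ y in Ω, ENNReal.ofReal (opNorm (Df y) ^ p) := by
      calc _ = ∫⁻ y in Ω, ENNReal.ofReal (Θ y) := by
            rw [← lintegral_indicator hΩ.measurableSet]
            refine lintegral_congr fun y => ?_
            by_cases hy : y ∈ Ω
            · simp only [hy, indicator_of_mem]
              rw [← ENNReal.rpow_mul, one_div_mul_cancel hp0.ne', ENNReal.rpow_one]
            · simp [hy, hp0]
        _ = _ := by
            refine lintegral_congr_ae ?_
            filter_upwards [hΘ] with y hy
            rw [hy]
    rw [h1]
    exact hS.lp.lintegral_lt_top.ne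
  · filter_upwards [hΘ, ae_restrict_mem hΩ.measurableSet] with y hy hyΩ i j
    have h0 : 0 ≤ opNorm (Df y) := norm_nonneg _
    rw [indicator_of_mem hyΩ, ← hy, ENNReal.ofReal_rpow_of_nonneg (by
      positivity) (by positivity), ← Real.rpow_mul h0, mul_one_div_cancel hp0.ne',
      Real.rpow_one, ← ofReal_norm]
    exact ENNReal.ofReal_le_ofReal (abs_entry_le _ i j)

end mollify


/-! ### Slice estimate -/

lemma ftc_enorm {n : ℕ} {g : Euc n → ℝ} (hg : ContDiff ℝ 1 g) (a v : Euc n) :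
    ‖g (a + v) - g a‖ₑ ≤ ∫⁻ l in Ioo (0 : ℝ) 1, ‖fderiv ℝ g (a + l • v) v‖ₑ := by
  have hd : ∀ l : ℝ, HasDerivAt (fun l : ℝ => g (a + l • v)) (fderiv ℝ g (a + l • v) v) l := by
    intro l
    have h1 : HasDerivAt (fun l : ℝ => a + l • v) v l := by
      simpa using ((hasDerivAt_id l).smul_const v).const_add a
    exact ((hg.differentiable (by norm_num)) (a + l • v)).hasFDerivAt.comp_hasDerivAt l h1
  have hc : Continuous (fun l : ℝ => fderiv ℝ g (a + l • v) v) := by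
    have := hg.continuous_fderiv (by norm_num)
    fun_prop
  have h2 := intervalIntegral.integral_eq_sub_of_hasDerivAt (a := 0) (b := 1)
    (fun l _ => hd l) (hc.intervalIntegrable 0 1)
  simp only [one_smul, zero_smul, add_zero] at h2
  rw [← h2, intervalIntegral.integral_of_le zero_le_one, setLIntegral_congr Ioo_ae_eq_Ioc]
  exact enorm_integral_le_lintegral_enorm _

lemma pt_seg {m : ℕ} (s : ℝ) (z e : Euc m) (l : ℝ) :
    pt s (z + l • (e - z)) = pt s z + l • (pt s e - pt s z) := by
  refine euc_ext ?_ ?_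
  · simp
  · rw [tl_add, tl_smul, tl_sub]; simp

lemma norm_pt_sub {m : ℕ} (s : ℝ) (z e : Euc m) : ‖pt s e - pt s z‖ = ‖e - z‖ := by
  have h := norm_sq_eq (pt s e - pt s z)
  rw [tl_sub] at h
  simp only [tl_pt, PiLp.sub_apply, pt_zero, sub_self] at h
  have h2 : ‖pt s e - pt s z‖ ^ 2 = ‖e - z‖ ^ 2 := by rw [h]; ring
  exact (sq_eq_sq₀ (norm_nonneg _) (norm_nonneg _)).1 h2

/-- The constant in the Morrey estimate. -/
def Jc (m : ℕ) (p : ℝ) : ℝ≥0∞ :=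
  ∫⁻ l in Ioo (0 : ℝ) 1, ENNReal.ofReal ((l ^ m)⁻¹) ^ (1 / p)

section
variable {m : ℕ} {p : ℝ} {Ω : Set (Euc (m + 1))} {f : Euc (m + 1) → Euc (m + 1)}
  {Df : Euc (m + 1) → Matrix (Fin (m + 1)) (Fin (m + 1)) ℝ}

lemma half_est (hp1 : 1 < p) (hΩ : IsOpen Ω) (hS : MemSobolev p Ω f Df) {i : Fin (m + 1)}
    (hI : Integrable (zext Ω f i) volume) {Ψ : Euc (m + 1) → ℝ≥0∞} (hΨm : Measurable Ψ)
    (hΨ : ∀ᵐ y ∂(volume.restrict Ω), ∀ i j, ‖Df y i j‖ₑ ≤ Ψ y)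
    (φ : ContDiffBump (0 : Euc (m + 1))) (s : ℝ) (z : Euc m) {E : Set (Euc m)}
    (hE : MeasurableSet E) {R : ℝ} (hR : ∀ e ∈ E, ‖e - z‖ ≤ R)
    (hseg : ∀ e ∈ E, ∀ l ∈ Icc (0 : ℝ) 1, closedBall (pt s (z + l • (e - z))) φ.rOut ⊆ Ω) :
    ∫⁻ e in E, ‖mol Ω f φ i (pt s e) - mol Ω f φ i (pt s z)‖ₑ ≤
      (((m + 1 : ℕ) : ℝ≥0∞) * ENNReal.ofReal R) * (Jc m p * ((volume E) ^ (1 - 1 / p) *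
        (∫⁻ x, molA Ψ φ (pt s x) ^ p) ^ (1 / p))) := by
  refine morrey_half hp1 (Q := fun x => molA Ψ φ (pt s x)) ?_ z hE _ _ ?_
  · exact (measurable_molA hΨm φ).comp
      (continuous_pt.comp (by fun_prop : Continuous fun x : Euc m => (s, x))).measurable
  · intro e he
    have h1 := ftc_enorm (contDiff_mol hI φ) (pt s z) (pt s e - pt s z)
    rw [add_sub_cancel] at h1
    refine h1.trans (setLIntegral_mono' measurableSet_Ioo fun l hl => ?_)
    rw [← pt_seg]
    refine (enorm_fderiv_mol_le hΩ hS hI hΨ φ _ _ (hseg e he l ⟨hl.1.le, hl.2.le⟩)).trans ?_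
    gcongr
    rw [← ofReal_norm, norm_pt_sub]
    exact ENNReal.ofReal_le_ofReal (hR e he)

lemma full_est (hp1 : 1 < p) (hΩ : IsOpen Ω) (hS : MemSobolev p Ω f Df) {i : Fin (m + 1)}
    (hI : Integrable (zext Ω f i) volume) {Ψ : Euc (m + 1) → ℝ≥0∞} (hΨm : Measurable Ψ)
    (hΨ : ∀ᵐ y ∂(volume.restrict Ω), ∀ i j, ‖Df y i j‖ₑ ≤ Ψ y)
    (φ : ContDiffBump (0 : Euc (m + 1))) (s : ℝ) (z w : Euc m) {E : Set (Euc m)}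
    (hE : MeasurableSet E) {R : ℝ} (hR : ∀ e ∈ E, ‖e - z‖ ≤ R) (hR' : ∀ e ∈ E, ‖e - w‖ ≤ R)
    (hseg : ∀ e ∈ E, ∀ l ∈ Icc (0 : ℝ) 1, closedBall (pt s (z + l • (e - z))) φ.rOut ⊆ Ω)
    (hseg' : ∀ e ∈ E, ∀ l ∈ Icc (0 : ℝ) 1, closedBall (pt s (w + l • (e - w))) φ.rOut ⊆ Ω) :
    ‖mol Ω f φ i (pt s z) - mol Ω f φ i (pt s w)‖ₑ * volume E ≤
      2 * ((((m + 1 : ℕ) : ℝ≥0∞) * ENNReal.ofReal R) * (Jc m p * ((volume E) ^ (1 - 1 / p) *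
        (∫⁻ x, molA Ψ φ (pt s x) ^ p) ^ (1 / p)))) := by
  have h1 := half_est hp1 hΩ hS hI hΨm hΨ φ s z hE hR hseg
  have h2 := half_est hp1 hΩ hS hI hΨm hΨ φ s w hE hR' hseg'
  rw [two_mul]
  refine le_trans ?_ (add_le_add h1 h2)
  have hc : Continuous (fun e => mol Ω f φ i (pt s e)) :=
    (contDiff_mol hI φ).continuous.comp
      (continuous_pt.comp (by fun_prop : Continuous fun x : Euc m => (s, x)))
  have hc2 : Measurable (fun e => ‖mol Ω f φ i (pt s e) - mol Ω f φ i (pt s z)‖ₑ) :=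
    (hc.measurable.sub_const _).enorm
  rw [← lintegral_add_left hc2]
  rw [← setLIntegral_const]
  refine lintegral_mono fun e => ?_
  have : mol Ω f φ i (pt s z) - mol Ω f φ i (pt s w) =
    -(mol Ω f φ i (pt s e) - mol Ω f φ i (pt s z)) +
      (mol Ω f φ i (pt s e) - mol Ω f φ i (pt s w)) := by ring
  calc _ = _ := by rw [this]
    _ ≤ _ := enorm_add_le _ _
    _ = _ := by rw [enorm_neg]

lemma slice_est (hp1 : 1 < p) (hΩ : IsOpen Ω) (hΩb : Ω ⊆ ball 0 1)
    (hS : MemSobolev p Ω f Df) (hfc : ContinuousOn f Ω) (hfb : ∀ x ∈ Ω, ‖f x‖ ≤ 1) :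
    ∃ M : ℝ → ℝ≥0∞, Measurable M ∧ ∫⁻ s, M s ≠ ⊤ ∧
      ∀ (s : ℝ) (z w x₁ : Euc m) (r R : ℝ) (c : ℝ≥0∞) (i : Fin (m + 1)),
        0 ≤ r →
        (∀ e ∈ closedBall x₁ r, ‖e - z‖ ≤ R) → (∀ e ∈ closedBall x₁ r, ‖e - w‖ ≤ R) →
        (∀ e ∈ closedBall x₁ r, ∀ l ∈ Icc (0 : ℝ) 1, pt s (z + l • (e - z)) ∈ Ω) →
        (∀ e ∈ closedBall x₁ r, ∀ l ∈ Icc (0 : ℝ) 1, pt s (w + l • (e - w)) ∈ Ω) →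
        M s < c →
        ‖f (pt s z) i - f (pt s w) i‖ₑ * volume (closedBall x₁ r) ≤
          2 * ((((m + 1 : ℕ) : ℝ≥0∞) * ENNReal.ofReal R) *
            (Jc m p * ((volume (closedBall x₁ r)) ^ (1 - 1 / p) * c ^ (1 / p)))) := by
  have hp0 : 0 < p := by linarith
  obtain ⟨Ψ, hΨm, hΨfin, hΨ⟩ := exists_Psi hp0 hΩ hS
  have hφ : ∀ k : ℕ, ∃ φ : ContDiffBump (0 : Euc (m + 1)), φ.rOut = 1 / ((k : ℝ) + 1) := fun k =>
    ⟨⟨1 / ((k : ℝ) + 1) / 2, 1 / ((k : ℝ) + 1), by positivity, by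
      have : (0 : ℝ) < 1 / ((k : ℝ) + 1) := by positivity
      linarith⟩, rfl⟩
  choose φ hφr using hφ
  have hφ0 : Filter.Tendsto (fun k => (φ k).rOut) Filter.atTop (nhds 0) := by
    simp only [hφr]; exact tendsto_one_div_add_atTop_nhds_zero_nat
  set Mk : ℕ → ℝ → ℝ≥0∞ := fun k s => ∫⁻ x, molA Ψ (φ k) (pt s x) ^ p with hMk
  have hMkm : ∀ k, Measurable (Mk k) := fun k =>
    Measurable.lintegral_prod_right' (f := fun q : ℝ × Euc m => molA Ψ (φ k) (pt q.1 q.2) ^ p)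
      (((measurable_molA hΨm (φ k)).comp continuous_pt.measurable).pow_const p)
  have hMkI : ∀ k, ∫⁻ s, Mk k s ≤ ∫⁻ y, Ψ y ^ p := fun k => by
    rw [← lintegral_slices ((measurable_molA hΨm (φ k)).pow_const p)]
    exact lintegral_molA_le hp1 hΨm (φ k)
  refine ⟨fun s => Filter.liminf (fun k => Mk k s) Filter.atTop, .liminf hMkm, ?_, ?_⟩
  · refine ne_top_of_le_ne_top hΨfin ((lintegral_liminf_le hMkm).trans ?_)
    refine Filter.liminf_le_of_le (by isBoundedDefault) fun b hb => ?_
    obtain ⟨k, hk⟩ := hb.exists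
    exact hk.trans (hMkI k)
  · intro s z w x₁ r R c i hr hRz hRw hz hw hc
    have hI := integrable_zext hΩ hΩb hfc hfb i
    have hfr : ∃ᶠ k in Filter.atTop, Mk k s < c :=
      Filter.frequently_lt_of_liminf_lt (by isBoundedDefault) hc
    have key : ∀ a : Euc m, (∀ e ∈ closedBall x₁ r, ∀ l ∈ Icc (0 : ℝ) 1,
        pt s (a + l • (e - a)) ∈ Ω) → ∀ᶠ k in Filter.atTop, ∀ e ∈ closedBall x₁ r,
          ∀ l ∈ Icc (0 : ℝ) 1, closedBall (pt s (a + l • (e - a))) (φ k).rOut ⊆ Ω := by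
      intro a ha
      set K : Set (Euc (m + 1)) := (fun q : Euc m × ℝ => pt s (a + q.2 • (q.1 - a))) ''
        (closedBall x₁ r ×ˢ Icc (0 : ℝ) 1) with hK
      have hKc : IsCompact K := ((isCompact_closedBall x₁ r).prod isCompact_Icc).image
        (continuous_pt.comp (by fun_prop : Continuous fun q : Euc m × ℝ =>
          (s, a + q.2 • (q.1 - a))))
      have hKΩ : K ⊆ Ω := by
        rintro _ ⟨⟨e, l⟩, ⟨he, hl⟩, rfl⟩
        exact ha e he l hl
      obtain ⟨δ, hδ, hsub⟩ := hKc.exists_cthickening_subset_open hΩ hKΩ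
      filter_upwards [hφ0.eventually (gt_mem_nhds hδ)] with k hk e he l hl
      refine subset_trans ?_ hsub
      refine (closedBall_subset_closedBall hk.le).trans ?_
      have hmem : pt s (a + l • (e - a)) ∈ K := ⟨(e, l), ⟨he, hl⟩, rfl⟩
      exact closedBall_subset_cthickening hmem δ
    have hr0 : x₁ ∈ closedBall x₁ r := mem_closedBall_self hr
    have hzΩ : pt s z ∈ Ω := by simpa using hz x₁ hr0 0 (by simp)
    have hwΩ : pt s w ∈ Ω := by simpa using hw x₁ hr0 0 (by simp)
    have hlim : Filter.Tendsto (fun k => ‖mol Ω f (φ k) i (pt s z) - mol Ω f (φ k) i (pt s w)‖ₑ *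
        volume (closedBall x₁ r)) Filter.atTop
        (nhds (‖f (pt s z) i - f (pt s w) i‖ₑ * volume (closedBall x₁ r))) := by
      refine ENNReal.Tendsto.mul_const ?_ (Or.inr measure_closedBall_lt_top.ne)
      exact ((tendsto_mol hΩ hfc hI hφ0 hzΩ).sub (tendsto_mol hΩ hfc hI hφ0 hwΩ)).enorm
    refine le_of_tendsto_of_frequently hlim ?_
    refine (hfr.and_eventually ((key z hz).and (key w hw))).mono fun k hk => ?_
    obtain ⟨hk1, hk2, hk3⟩ := hk
    refine (full_est hp1 hΩ hS hI hΨm hΨ (φ k) s z w measurableSet_closedBall hRz hRw hk2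
      hk3).trans ?_
    have : ∫⁻ x, molA Ψ (φ k) (pt s x) ^ p ≤ c := hk1.le
    gcongr

end


/-! ### Oscillation near the cusp side -/

lemma norm_le_of_coord {n : ℕ} (v : Euc n) {d : ℝ} (hd : 0 ≤ d) (h : ∀ i, |v i| ≤ d) :
    ‖v‖ ≤ n * d := by
  have h1 : ‖v‖ ^ 2 ≤ (n * d) ^ 2 := by
    rw [EuclideanSpace.norm_sq_eq]
    calc ∑ i, ‖v i‖ ^ 2 ≤ ∑ _i : Fin n, d ^ 2 := by
          refine Finset.sum_le_sum fun i _ => ?_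
          exact pow_le_pow_left₀ (norm_nonneg _) (h i) 2
      _ = n * d ^ 2 := by simp
      _ ≤ (n * d) ^ 2 := by
          have : (n : ℝ) ≤ (n : ℝ) ^ 2 := by
            rcases Nat.eq_zero_or_pos n with h0 | h0
            · simp [h0]
            · have : (1 : ℝ) ≤ n := by exact_mod_cast h0
              nlinarith
          rw [mul_pow]; gcongr
  exact le_of_sq_le_sq h1 (by positivity)

lemma seg_mem {m : ℕ} {u : ℝ → ℝ} {y : Euc (m + 1)}
    (hN : 0 < ‖tl y‖) {r : ℝ} (hr0 : 0 < r) (hrN : r ≤ ‖tl y‖)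
    (hr1 : 3 * r < 1 - ‖y‖) {z : Euc (m + 1)} (hz : z ∈ cuspBall (m + 1) u)
    (hz0 : 0 ≤ z 0) (hzy : dist z y ≤ r / 4) {e : Euc m}
    (he : e ∈ closedBall ((1 + r / ‖tl y‖) • tl y) (r / 4)) :
    ‖e - tl z‖ ≤ 2 * r ∧
      ∀ l ∈ Icc (0 : ℝ) 1, pt (z 0) (tl z + l • (e - tl z)) ∈ cuspBall (m + 1) u := by
  set x₀ := tl y with hx₀
  set N := ‖x₀‖ with hNdef
  set ê := (r / N) • x₀ with hê
  have hên : ‖ê‖ = r := by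
    rw [hê, norm_smul, Real.norm_of_nonneg (by positivity)]
    rw [← hNdef]; field_simp
  have hZ : ‖x₀ - tl z‖ ≤ r / 4 := by
    rw [hx₀, ← tl_sub]
    refine (norm_tl_le _).trans ?_
    rw [← dist_eq_norm, dist_comm]; exact hzy
  have he' : ‖e - (x₀ + ê)‖ ≤ r / 4 := by
    rw [mem_closedBall, dist_eq_norm, add_smul, one_smul] at he
    exact he
  have hdec : e - tl z = ê + ((e - (x₀ + ê)) + (x₀ - tl z)) := by abel
  have h2r : ‖e - tl z‖ ≤ 2 * r := by
    rw [hdec]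
    have := norm_add_le ê ((e - (x₀ + ê)) + (x₀ - tl z))
    have := norm_add_le (e - (x₀ + ê)) (x₀ - tl z)
    linarith
  refine ⟨h2r, fun l hl => ?_⟩
  have hin : 0 ≤ inner ℝ (tl z) (e - tl z) := by
    have h1 : inner ℝ x₀ ê = r * N := by
      rw [hê, inner_smul_right, real_inner_self_eq_norm_sq, ← hNdef]; field_simp
    have h2 : inner ℝ (tl z) (e - tl z) = inner ℝ x₀ ê - inner ℝ (x₀ - tl z) ê +
        inner ℝ (tl z) ((e - (x₀ + ê)) + (x₀ - tl z)) := by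
      rw [inner_sub_left]
      conv_lhs => rw [hdec, inner_add_right]
      ring
    have h3 := real_inner_le_norm (x₀ - tl z) ê
    have h4 : -(‖tl z‖ * ‖(e - (x₀ + ê)) + (x₀ - tl z)‖) ≤
        inner ℝ (tl z) ((e - (x₀ + ê)) + (x₀ - tl z)) :=
      neg_le_of_abs_le (abs_real_inner_le_norm _ _)
    have h5 : ‖tl z‖ ≤ N + r / 4 := by
      have := norm_sub_norm_le (tl z) x₀
      rw [norm_sub_rev] at this
      linarith
    have h6 : ‖(e - (x₀ + ê)) + (x₀ - tl z)‖ ≤ r / 2 := by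
      have := norm_add_le (e - (x₀ + ê)) (x₀ - tl z)
      linarith
    have h7 : ‖tl z‖ * ‖(e - (x₀ + ê)) + (x₀ - tl z)‖ ≤ (N + r / 4) * (r / 2) :=
      mul_le_mul h5 h6 (norm_nonneg _) (by positivity)
    have h8 : ‖x₀ - tl z‖ * ‖ê‖ ≤ r / 4 * r := by rw [hên]; gcongr
    rw [h2, h1]
    nlinarith
  rw [mem_cuspBall] at hz ⊢
  constructor
  · have h1 : pt (z 0) (tl z + l • (e - tl z)) = z + l • (pt (z 0) e - z) := by
      rw [pt_seg, pt_tl]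
    have h2 : ‖pt (z 0) e - z‖ = ‖e - tl z‖ := by
      conv_lhs => rw [← pt_tl z]
      rw [pt_zero, norm_pt_sub]
    rw [h1]
    have h3 : ‖z‖ ≤ ‖y‖ + r / 4 := by
      have := norm_sub_norm_le z y
      rw [← dist_eq_norm] at this
      linarith
    have h4 := norm_add_le z (l • (pt (z 0) e - z))
    have h5 : ‖l • (pt (z 0) e - z)‖ ≤ 2 * r := by
      rw [norm_smul, h2, Real.norm_of_nonneg hl.1]
      calc l * ‖e - tl z‖ ≤ 1 * (2 * r) := by
            gcongr; exact hl.2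
        _ = _ := one_mul _
    linarith
  · right
    rw [pt_zero, tl_pt]
    have h1 : u (z 0) < ‖tl z‖ := by
      rcases hz.2 with h | h
      · exact absurd h (not_lt.2 hz0)
      · exact h
    refine h1.trans_le ?_
    refine le_of_sq_le_sq ?_ (norm_nonneg _)
    rw [norm_add_sq_real, inner_smul_right]
    have := mul_nonneg hl.1 hin
    nlinarith [sq_nonneg ‖l • (e - tl z)‖]

lemma osc {m : ℕ} {p : ℝ} (hm : 1 ≤ m) (hp : (m : ℝ) < p) {u : ℝ → ℝ} (hu : IsModelCusp u)
    {f : Euc (m + 1) → Euc (m + 1)} {M : ℝ → ℝ≥0∞}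
    (hM : ∀ (s : ℝ) (z w x₁ : Euc m) (r R : ℝ) (c : ℝ≥0∞) (i : Fin (m + 1)),
        0 ≤ r →
        (∀ e ∈ closedBall x₁ r, ‖e - z‖ ≤ R) → (∀ e ∈ closedBall x₁ r, ‖e - w‖ ≤ R) →
        (∀ e ∈ closedBall x₁ r, ∀ l ∈ Icc (0 : ℝ) 1,
          pt s (z + l • (e - z)) ∈ cuspBall (m + 1) u) →
        (∀ e ∈ closedBall x₁ r, ∀ l ∈ Icc (0 : ℝ) 1,
          pt s (w + l • (e - w)) ∈ cuspBall (m + 1) u) →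
        M s < c →
        ‖f (pt s z) i - f (pt s w) i‖ₑ * volume (closedBall x₁ r) ≤
          2 * ((((m + 1 : ℕ) : ℝ≥0∞) * ENNReal.ofReal R) *
            (Jc m p * ((volume (closedBall x₁ r)) ^ (1 - 1 / p) * c ^ (1 / p)))))
    {y : Euc (m + 1)} (hy0 : 0 < y 0) (hyu : ‖tl y‖ = u (y 0)) (hy1 : ‖y‖ < 1)
    {L : ℝ≥0∞} (hL : L ≠ ⊤) {δ : ℝ} (hδ : 0 < δ) :
    ∃ ρ > 0, ∀ z ∈ cuspBall (m + 1) u, ∀ w ∈ cuspBall (m + 1) u, dist z y < ρ → dist w y < ρ →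
      z 0 = w 0 → M (z 0) < L → ‖f z - f w‖ ≤ δ := by
  have hp0 : 0 < p := lt_of_le_of_lt (Nat.cast_nonneg m) hp
  have hN : 0 < ‖tl y‖ := by rw [hyu]; exact hu.pos hy0
  -- constants
  set v₁ : ℝ≥0∞ := volume (ball (0 : Euc m) 1) with hv₁
  have hv₁t : v₁ ≠ ⊤ := measure_ball_lt_top.ne
  have hv₁0 : 0 < v₁.toReal := ENNReal.toReal_pos (measure_ball_pos _ _ one_pos).ne' hv₁t
  have hJ : Jc m p ≠ ⊤ := J_ne_top hp
  set K : ℝ := 2 * (((m + 1 : ℕ) : ℝ) * ((Jc m p).toReal * L.toReal ^ (1 / p))) with hK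
  have hK0 : 0 ≤ K := by positivity
  set c₁ : ℝ := (1 / 4) ^ m * v₁.toReal with hc₁
  have hc₁0 : 0 < c₁ := by positivity
  have hex : 0 < 1 - m / p := by
    have : (m : ℝ) / p < 1 := by rw [div_lt_one hp0]; exact hp
    linarith
  -- choice of r
  have hlim : Filter.Tendsto (fun r : ℝ => 2 * K * c₁ ^ (-(1 / p)) * r ^ (1 - m / p))
      (nhdsWithin 0 (Ioi 0)) (nhds 0) := by
    have h1 : Filter.Tendsto (fun r : ℝ => r ^ (1 - m / p)) (nhds 0) (nhds 0) := by
      have := (Real.continuous_rpow_const hex.le).tendsto 0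
      rwa [Real.zero_rpow hex.ne'] at this
    have h2 := (h1.const_mul (2 * K * c₁ ^ (-(1 / p)))).mono_left
      (nhdsWithin_le_nhds (s := Ioi (0 : ℝ)))
    simpa using h2
  have hδ' : 0 < δ / ((m + 1 : ℕ) : ℝ) := by positivity
  have ev1 := hlim.eventually (gt_mem_nhds hδ')
  have ev2 : ∀ᶠ r in nhdsWithin (0 : ℝ) (Ioi 0), r < min ‖tl y‖ ((1 - ‖y‖) / 3) := by
    refine (gt_mem_nhds ?_ : ∀ᶠ r in nhds (0 : ℝ), _).filter_mono nhdsWithin_le_nhds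
    refine lt_min hN (by linarith)
  obtain ⟨r, ⟨hr1, hr2⟩, hr0⟩ := ((ev1.and ev2).and self_mem_nhdsWithin).exists
  have hr0 : 0 < r := hr0
  have hrN : r ≤ ‖tl y‖ := (hr2.trans_le (min_le_left _ _)).le
  have hr3 : 3 * r < 1 - ‖y‖ := by
    have := hr2.trans_le (min_le_right _ _); linarith
  refine ⟨min (r / 4) (y 0), lt_min (by positivity) hy0, fun z hz w hw hzy hwy hzw hML => ?_⟩
  have pos : ∀ z : Euc (m + 1), dist z y < min (r / 4) (y 0) → 0 ≤ z 0 := by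
    intro z hz
    have h1 := abs_fst_le (y - z)
    rw [← dist_eq_norm, dist_comm] at h1
    have h2 := (le_abs_self _).trans h1
    have h3 := hz.trans_le (min_le_right _ _)
    simp only [PiLp.sub_apply] at h2
    linarith
  have sz := fun e (he : e ∈ closedBall ((1 + r / ‖tl y‖) • tl y) (r / 4)) =>
    seg_mem hN hr0 hrN hr3 hz (pos z hzy) (hzy.le.trans (min_le_left _ _)) he
  have sw := fun e (he : e ∈ closedBall ((1 + r / ‖tl y‖) • tl y) (r / 4)) =>
    seg_mem hN hr0 hrN hr3 hw (pos w hwy) (hwy.le.trans (min_le_left _ _)) he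
  have hcoord : ∀ i, |(f z - f w) i| ≤ δ / ((m + 1 : ℕ) : ℝ) := by
    intro i
    have h := hM (z 0) (tl z) (tl w) ((1 + r / ‖tl y‖) • tl y) (r / 4) (2 * r) L i (by positivity)
      (fun e he => (sz e he).1) (fun e he => (sw e he).1) (fun e he => (sz e he).2)
      (fun e he => by rw [hzw]; exact (sw e he).2) hML
    rw [pt_tl, hzw, pt_tl] at h
    have hV : volume (closedBall ((1 + r / ‖tl y‖) • tl y) (r / 4)) =
        ENNReal.ofReal (c₁ * r ^ m) := by
      rw [Measure.addHaar_closedBall _ _ (by positivity), ← hv₁, ← ENNReal.ofReal_toReal hv₁t,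
        ← ENNReal.ofReal_mul (by positivity)]
      simp only [finrank_euclideanSpace, Fintype.card_fin]
      congr 1
      rw [hc₁, div_pow, div_pow, one_pow]; ring
    have ha : 0 < c₁ * r ^ m := by positivity
    rw [hV] at h
    have h1 := ENNReal.toReal_mono (by
      refine ENNReal.mul_ne_top (by norm_num) (ENNReal.mul_ne_top
        (ENNReal.mul_ne_top (ENNReal.natCast_ne_top _) ENNReal.ofReal_ne_top)
        (ENNReal.mul_ne_top hJ (ENNReal.mul_ne_top ?_ ?_)))
      · rw [ENNReal.ofReal_rpow_of_pos ha]; exact ENNReal.ofReal_ne_top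
      · exact ENNReal.rpow_ne_top_of_nonneg (by positivity) hL) h
    simp only [ENNReal.toReal_mul, toReal_enorm, ← ENNReal.toReal_rpow,
      ENNReal.toReal_ofReal ha.le, ENNReal.toReal_ofReal (by positivity : (0 : ℝ) ≤ 2 * r),
      ENNReal.toReal_natCast, ENNReal.toReal_ofNat] at h1
    have h2 : ‖f z i - f w i‖ * (c₁ * r ^ m) ≤
        (K * (2 * r) * (c₁ * r ^ m) ^ (-(1 / p))) * (c₁ * r ^ m) := by
      refine h1.trans (le_of_eq ?_)
      rw [sub_eq_add_neg, Real.rpow_add ha, Real.rpow_one, hK]; ring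
    have h3 := le_of_mul_le_mul_right h2 ha
    have h4 : K * (2 * r) * (c₁ * r ^ m) ^ (-(1 / p)) =
        2 * K * c₁ ^ (-(1 / p)) * r ^ (1 - m / p) := by
      rw [Real.mul_rpow hc₁0.le (by positivity), ← Real.rpow_natCast, ← Real.rpow_mul hr0.le,
        sub_eq_add_neg, Real.rpow_add hr0, Real.rpow_one]
      have : (m : ℝ) * -(1 / p) = -(m / p) := by ring
      rw [this]; ring
    rw [h4] at h3
    have h5 := h3.trans hr1.le
    simpa using h5
  have := norm_le_of_coord _ hδ'.le hcoord
  refine this.trans (le_of_eq ?_)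
  field_simp


/-! ### Conclusion -/

lemma ae_two_sided {M : ℝ → ℝ≥0∞} (hMm : Measurable M) (hM : ∫⁻ s, M s ≠ ⊤) :
    ∀ᵐ τ : ℝ, ∃ L : ℝ≥0∞, L ≠ ⊤ ∧ (∀ η > 0, ∃ s ∈ Ioo (τ - η) τ, M s < L) ∧
      (∀ η > 0, ∃ s ∈ Ioo τ (τ + η), M s < L) := by
  have h1 : ∀ᵐ τ : ℝ, M τ < ⊤ := ae_lt_top hMm hM
  have h2 : ∀ᵐ τ : ℝ, ∀ k : ℕ, τ ∉ {x ∈ {s | M s < k} | nhdsWithin x ({s | M s < k} ∩ Ioi x) = ⊥} :=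
    ae_all_iff.2 fun k => countable_setOfPred_isolated_right_within.ae_notMem _
  have h3 : ∀ᵐ τ : ℝ, ∀ k : ℕ, τ ∉ {x ∈ {s | M s < k} | nhdsWithin x ({s | M s < k} ∩ Iio x) = ⊥} :=
    ae_all_iff.2 fun k => countable_setOfPred_isolated_left_within.ae_notMem _
  filter_upwards [h1, h2, h3] with τ h1 h2 h3
  obtain ⟨k, hk⟩ := ENNReal.exists_nat_gt h1.ne
  have h2' : (nhdsWithin τ ({s | M s < k} ∩ Ioi τ)).NeBot := ⟨fun h => h2 k ⟨hk, h⟩⟩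
  have h3' : (nhdsWithin τ ({s | M s < k} ∩ Iio τ)).NeBot := ⟨fun h => h3 k ⟨hk, h⟩⟩
  rw [← mem_closure_iff_nhdsWithin_neBot, Metric.mem_closure_iff] at h2' h3'
  refine ⟨k, ENNReal.natCast_ne_top k, fun η hη => ?_, fun η hη => ?_⟩
  · obtain ⟨s, ⟨hs1, hs2⟩, hs3⟩ := h3' η hη
    rw [Real.dist_eq, abs_lt] at hs3
    exact ⟨s, ⟨by linarith, hs2⟩, hs1⟩
  · obtain ⟨s, ⟨hs1, hs2⟩, hs3⟩ := h2' η hη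
    rw [Real.dist_eq, abs_lt] at hs3
    exact ⟨s, ⟨hs2, by linarith⟩, hs1⟩

/-- The slices `I s`, `s` close to `τ` satisfying the filter condition, approach `a`. -/
def App {m : ℕ} (h : Euc (m + 1) → Euc (m + 1)) (I : ℝ → Set ℝ) (a : Euc (m + 1)) : Prop :=
  ∀ ρ > 0, ∃ η > 0, ∀ s ∈ I η, ∃ x ∈ unitBall (m + 1), dist x a < ρ ∧ (h x) 0 = s

namespace ExtData
variable {m : ℕ} {u : ℝ → ℝ} {h f H : Euc (m + 1) → Euc (m + 1)}

lemma app_one (E : ExtData m u h f H) {a : Euc (m + 1)} (ha : a ∈ closedBall (0 : Euc (m + 1)) 1)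
    {τ : ℝ} (hτ : (H a) 0 = τ) {ρ : ℝ} (hρ : 0 < ρ) :
    (∃ η > 0, ∀ s ∈ Ioo (τ - η) τ, ∃ x ∈ unitBall (m + 1), dist x a < ρ ∧ (h x) 0 = s) ∨
    (∃ η > 0, ∀ s ∈ Ioo τ (τ + η), ∃ x ∈ unitBall (m + 1), dist x a < ρ ∧ (h x) 0 = s) := by
  set N : Set (Euc (m + 1)) := unitBall (m + 1) ∩ ball a ρ with hN
  set I : Set ℝ := (fun x => (h x) 0) '' N with hI
  have hNc : IsPreconnected N := ((convex_ball 0 1).inter (convex_ball a ρ)).isPreconnected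
  have hcont : ContinuousOn (fun x => (h x) 0) N :=
    continuous_fst'.comp_continuousOn (E.hhf.continuousOn.mono inter_subset_left)
  have hIo : I.OrdConnected := (hNc.image _ hcont).ordConnected
  have hne := mem_clos ha
  have hclos : ∀ ε > 0, ∃ s ∈ I, |s - τ| < ε := by
    intro ε hε
    have h1 : Filter.Tendsto (fun x => (H x) 0) (nhdsWithin a (unitBall (m + 1))) (nhds τ) := by
      rw [← hτ]
      exact (continuous_fst'.tendsto (H a)).comp (E.tendsto_H ha)
    have h2 := h1.eventually (Metric.ball_mem_nhds τ hε)
    have h3 : ∀ᶠ x in nhdsWithin a (unitBall (m + 1)), x ∈ ball a ρ :=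
      nhdsWithin_le_nhds (Metric.ball_mem_nhds a hρ)
    obtain ⟨x, ⟨hx1, hx2⟩, hx3⟩ := ((h2.and h3).and self_mem_nhdsWithin).exists
    refine ⟨(h x) 0, ⟨x, ⟨hx3, hx2⟩, rfl⟩, ?_⟩
    rw [E.hHeq hx3] at hx1
    exact hx1
  have hs0 : ∃ s ∈ I, s ≠ τ := by
    obtain ⟨s, ⟨x, hx, hxs⟩, -⟩ := hclos 1 one_pos
    by_cases hsτ : s = τ
    · have hW : IsOpen (cuspBall (m + 1) u ∩ f ⁻¹' (ball a ρ)) :=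
        E.hhf.continuousOn_inv.isOpen_inter_preimage (isOpen_cuspBall E.hu) isOpen_ball
      have hmem : h x ∈ cuspBall (m + 1) u ∩ f ⁻¹' (ball a ρ) :=
        ⟨E.hhf.mapsTo hx.1, by
          rw [mem_preimage, E.hhf.left_inv x hx.1]; exact hx.2⟩
      have hc : Filter.Tendsto (fun ε : ℝ => h x + ε • pt 1 (0 : Euc m)) (nhdsWithin 0 (Ioi 0))
          (nhds (h x)) := by
        have : Continuous (fun ε : ℝ => h x + ε • pt 1 (0 : Euc m)) := by fun_prop
        have h5 := this.tendsto 0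
        simp only [zero_smul, add_zero] at h5
        exact h5.mono_left nhdsWithin_le_nhds
      obtain ⟨ε, h6, h7⟩ := ((hc.eventually (hW.mem_nhds hmem)).and self_mem_nhdsWithin).exists
      refine ⟨s + ε, ⟨f (h x + ε • pt 1 (0 : Euc m)), ⟨E.hhf.mapsTo_inv h6.1, h6.2⟩, ?_⟩, ?_⟩
      · simp only
        rw [E.hhf.right_inv _ h6.1]
        simp only [PiLp.add_apply, PiLp.smul_apply, pt_zero, smul_eq_mul, mul_one]
        rw [← hxs]
      · have h7 : 0 < ε := h7
        rw [hsτ]; linarith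
    · exact ⟨s, ⟨x, hx, hxs⟩, hsτ⟩
  obtain ⟨s₀, hs₀, hne0⟩ := hs0
  have fin : ∀ s ∈ I, ∃ x ∈ unitBall (m + 1), dist x a < ρ ∧ (h x) 0 = s := by
    rintro s ⟨x, hx, hxs⟩
    exact ⟨x, hx.1, hx.2, hxs⟩
  rcases lt_or_gt_of_ne hne0 with hlt | hlt
  · left
    refine ⟨τ - s₀, by linarith, fun s hs => fin s ?_⟩
    obtain ⟨s', hs', hs''⟩ := hclos (τ - s) (by linarith [hs.2])
    rw [abs_lt] at hs''
    exact hIo.out hs₀ hs' ⟨by linarith [hs.1], by linarith⟩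
  · right
    refine ⟨s₀ - τ, by linarith, fun s hs => fin s ?_⟩
    obtain ⟨s', hs', hs''⟩ := hclos (s - τ) (by linarith [hs.1])
    rw [abs_lt] at hs''
    exact hIo.out hs' hs₀ ⟨by linarith, by linarith [hs.2]⟩

lemma app_or (E : ExtData m u h f H) {a : Euc (m + 1)} (ha : a ∈ closedBall (0 : Euc (m + 1)) 1)
    {τ : ℝ} (hτ : (H a) 0 = τ) :
    App h (fun η => Ioo (τ - η) τ) a ∨ App h (fun η => Ioo τ (τ + η)) a := by
  by_contra hcon
  rw [not_or] at hcon
  obtain ⟨h1, h2⟩ := hcon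
  unfold App at h1 h2
  push Not at h1 h2
  obtain ⟨ρ₁, hρ₁, h1⟩ := h1
  obtain ⟨ρ₂, hρ₂, h2⟩ := h2
  rcases E.app_one ha hτ (lt_min hρ₁ hρ₂) with ⟨η, hη, h3⟩ | ⟨η, hη, h3⟩
  · obtain ⟨s, hs, h4⟩ := h1 η hη
    obtain ⟨x, hx, hxa, hxs⟩ := h3 s hs
    exact h4 x hx (hxa.trans_le (min_le_left _ _)) hxs
  · obtain ⟨s, hs, h4⟩ := h2 η hη
    obtain ⟨x, hx, hxa, hxs⟩ := h3 s hs
    exact h4 x hx (hxa.trans_le (min_le_right _ _)) hxs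

lemma app_unique (E : ExtData m u h f H) {M : ℝ → ℝ≥0∞} {L : ℝ≥0∞} {y : Euc (m + 1)}
    (hosc : ∀ δ : ℝ, 0 < δ → ∃ ρ > 0, ∀ z ∈ cuspBall (m + 1) u, ∀ w ∈ cuspBall (m + 1) u,
      dist z y < ρ → dist w y < ρ → z 0 = w 0 → M (z 0) < L → ‖f z - f w‖ ≤ δ)
    {I : ℝ → Set ℝ} (hmono : ∀ η η', η ≤ η' → I η ⊆ I η')
    (hI : ∀ η > 0, ∃ s ∈ I η, M s < L) {a b : Euc (m + 1)}
    (ha : a ∈ closedBall (0 : Euc (m + 1)) 1) (hb : b ∈ closedBall (0 : Euc (m + 1)) 1)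
    (hay : H a = y) (hby : H b = y) (haI : App h I a) (hbI : App h I b) : a = b := by
  by_contra hab
  have hd : 0 < dist a b := dist_pos.2 hab
  obtain ⟨ρ, hρ, hosc⟩ := hosc (dist a b / 4) (by positivity)
  have cont : ∀ c ∈ closedBall (0 : Euc (m + 1)) 1, H c = y →
      ∃ ρ₁ > 0, ∀ x ∈ unitBall (m + 1), dist x c < ρ₁ → dist (h x) y < ρ := by
    intro c hc hcy
    obtain ⟨ρ₁, h1, h2⟩ := Metric.continuousOn_iff.1 E.hHc c hc ρ hρ
    refine ⟨ρ₁, h1, fun x hx hxc => ?_⟩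
    have := h2 x (ball_sub hx) hxc
    rwa [hcy, E.hHeq hx] at this
  obtain ⟨ρa, hρa, ca⟩ := cont a ha hay
  obtain ⟨ρb, hρb, cb⟩ := cont b hb hby
  obtain ⟨ηa, hηa, ka⟩ := haI (min ρa (dist a b / 4)) (lt_min hρa (by positivity))
  obtain ⟨ηb, hηb, kb⟩ := hbI (min ρb (dist a b / 4)) (lt_min hρb (by positivity))
  obtain ⟨s, hs, hsL⟩ := hI (min ηa ηb) (lt_min hηa hηb)
  obtain ⟨x, hx, hxa, hxs⟩ := ka s (hmono _ _ (min_le_left _ _) hs)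
  obtain ⟨x', hx', hxb, hxs'⟩ := kb s (hmono _ _ (min_le_right _ _) hs)
  have h1 := hosc (h x) (E.hhf.mapsTo hx) (h x') (E.hhf.mapsTo hx')
    (ca x hx (hxa.trans_le (min_le_left _ _))) (cb x' hx' (hxb.trans_le (min_le_left _ _)))
    (hxs.trans hxs'.symm) (by rw [hxs]; exact hsL)
  rw [E.hhf.left_inv x hx, E.hhf.left_inv x' hx', ← dist_eq_norm] at h1
  have h2 := hxa.trans_le (min_le_right _ _)
  have h3 := hxb.trans_le (min_le_right _ _)
  have h4 := dist_triangle a x b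
  have h5 := dist_triangle x x' b
  rw [dist_comm a x] at h4
  linarith

lemma fiber_unique (E : ExtData m u h f H) {M : ℝ → ℝ≥0∞} {L : ℝ≥0∞} {y : Euc (m + 1)}
    (hy : y ∈ cuspD m u)
    (hosc : ∀ δ : ℝ, 0 < δ → ∃ ρ > 0, ∀ z ∈ cuspBall (m + 1) u, ∀ w ∈ cuspBall (m + 1) u,
      dist z y < ρ → dist w y < ρ → z 0 = w 0 → M (z 0) < L → ‖f z - f w‖ ≤ δ)
    (hl : ∀ η > 0, ∃ s ∈ Ioo (y 0 - η) (y 0), M s < L)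
    (hr : ∀ η > 0, ∃ s ∈ Ioo (y 0) (y 0 + η), M s < L) :
    (closedBall (0 : Euc (m + 1)) 1 ∩ H ⁻¹' {y}).Subsingleton := by
  by_contra hcon
  rw [not_subsingleton_iff] at hcon
  refine (E.fiber_conn hy).infinite_of_nontrivial hcon ?_
  have hsub : closedBall (0 : Euc (m + 1)) 1 ∩ H ⁻¹' {y} ⊆
      {a ∈ closedBall (0 : Euc (m + 1)) 1 ∩ H ⁻¹' {y} | App h (fun η => Ioo (y 0 - η) (y 0)) a} ∪
      {a ∈ closedBall (0 : Euc (m + 1)) 1 ∩ H ⁻¹' {y} | App h (fun η => Ioo (y 0) (y 0 + η)) a} := by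
    intro a ha
    have hay : H a = y := ha.2
    rcases E.app_or ha.1 (τ := y 0) (by rw [hay]) with h1 | h1
    · exact Or.inl ⟨ha, h1⟩
    · exact Or.inr ⟨ha, h1⟩
  refine Set.Finite.subset (Set.Finite.union ?_ ?_) hsub
  · refine Set.Subsingleton.finite fun a ha b hb => ?_
    exact E.app_unique hosc (fun η η' hη => Ioo_subset_Ioo (by linarith) le_rfl) hl
      ha.1.1 hb.1.1 ha.1.2 hb.1.2 ha.2 hb.2
  · refine Set.Subsingleton.finite fun a ha b hb => ?_
    exact E.app_unique hosc (fun η η' hη => Ioo_subset_Ioo le_rfl (by linarith)) hr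
      ha.1.1 hb.1.1 ha.1.2 hb.1.2 ha.2 hb.2

end ExtData

lemma ae_transfer {u : ℝ → ℝ} (hu : IsModelCusp u) {P : ℝ → Prop} (hP : ∀ᵐ τ : ℝ, P τ) :
    ∀ᵐ t : ℝ, ∀ τ : ℝ, 0 < τ → Real.sqrt (τ ^ 2 + u τ ^ 2) = t → P τ := by
  set g : ℝ → ℝ := fun τ => Real.sqrt (τ ^ 2 + u τ ^ 2) with hg
  have hd : DifferentiableOn ℝ g ({τ | ¬ P τ} ∩ Ioi 0) := by
    intro τ hτ
    have hτ0 : 0 < τ := hτ.2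
    have hud : DifferentiableAt ℝ u τ :=
      (hu.contDiffOn.differentiableOn (by norm_num)).differentiableAt (Ioi_mem_nhds hτ0)
    have : DifferentiableAt ℝ g τ := by
      refine DifferentiableAt.sqrt (by fun_prop) ?_
      positivity
    exact this.differentiableWithinAt
  have h0 : volume ({τ | ¬ P τ} ∩ Ioi 0) = 0 := measure_mono_null inter_subset_left hP
  have h1 := addHaar_image_eq_zero_of_differentiableOn_of_addHaar_eq_zero volume hd h0
  have h2 : ∀ᵐ t : ℝ, t ∉ g '' ({τ | ¬ P τ} ∩ Ioi 0) := measure_eq_zero_iff_ae_notMem.1 h1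
  filter_upwards [h2] with t ht τ hτ hτt
  by_contra hcon
  exact ht ⟨τ, ⟨hcon, hτ⟩, hτt⟩

lemma main_aux {m : ℕ} (hm : 2 ≤ m) {p : ℝ} (hp : (m : ℝ) < p) {u : ℝ → ℝ}
    {h f H : Euc (m + 1) → Euc (m + 1)} (E : ExtData m u h f H)
    {Df : Euc (m + 1) → Matrix (Fin (m + 1)) (Fin (m + 1)) ℝ}
    (hS : MemSobolev p (cuspBall (m + 1) u) f Df) :
    ∀ᵐ t ∂(volume.restrict (Set.Ioo (0 : ℝ) 1)),
      ∃ U V : Set (Euc (m + 1)),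
        U ∪ V = Metric.sphere (0 : Euc (m + 1)) 1 \ cuspC' (m + 1) u h t ∧
        Disjoint U V ∧
        IsConnected U ∧ IsConnected V ∧
        (∃ U₀ : Set (Euc (m + 1)), IsOpen U₀ ∧ U = U₀ ∩ Metric.sphere (0 : Euc (m + 1)) 1) ∧
        (∃ V₀ : Set (Euc (m + 1)), IsOpen V₀ ∧ V = V₀ ∩ Metric.sphere (0 : Euc (m + 1)) 1) ∧
        closure U \ U = cuspC' (m + 1) u h t ∧
        closure V \ V = cuspC' (m + 1) u h t := by
  have hu := E.hu
  have hp1 : 1 < p := by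
    have : (2 : ℝ) ≤ m := by exact_mod_cast hm
    linarith
  have hsub : cuspBall (m + 1) u ⊆ ball 0 1 := fun x hx => by
    rw [mem_ball_zero_iff]; exact (mem_cuspBall.1 hx).1
  obtain ⟨M, hMm, hMfin, hM⟩ := slice_est hp1 (isOpen_cuspBall hu) hsub hS
    E.hhf.continuousOn_inv (fun x hx => (mem_ball_zero_iff.1 (E.hhf.mapsTo_inv hx)).le)
  have hae := ae_transfer hu (ae_two_sided hMm hMfin)
  rw [ae_restrict_iff' measurableSet_Ioo]
  filter_upwards [hae] with t ht ht01
  refine assembly hm E ht01 fun x hx hxt z hz hzx => ?_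
  have hxc : x ∈ closedBall (0 : Euc (m + 1)) 1 := sphere_subset_closedBall hx
  have hy : H x ∈ cuspD m u := E.hHmaps hxc
  have hy1 : ‖H x‖ < 1 := by rw [hxt]; exact ht01.2
  have hnot : H x ∉ cuspBall (m + 1) u := by
    intro hcon
    have h1 : ‖x‖ < 1 := mem_ball_zero_iff.1 (E.mem_ball_of hxc hcon)
    rw [mem_sphere_zero_iff_norm] at hx
    linarith
  obtain ⟨hy0, hyu⟩ := side_of hu hy hnot hy1
  have hy0' := side_pos hu ht01.1 hy0 hyu hxt
  have hg : Real.sqrt ((H x) 0 ^ 2 + u ((H x) 0) ^ 2) = t := by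
    rw [← hyu, ← norm_sq_eq, hxt, Real.sqrt_sq ht01.1.le]
  obtain ⟨L, hL, hl, hr⟩ := ht _ hy0' hg
  refine E.fiber_unique hy (fun δ hδ => osc (by omega) hp hu hM hy0' hyu hy1 hL hδ) hl hr
    ⟨hz, hzx⟩ ⟨hxc, rfl⟩

/-- For a.e. `t ∈ (0,1)` the set `∂𝔹 ∖ C′_t` consists of exactly two
disjoint nonempty connected relatively open pieces whose common relative boundary is `C′_t`. -/
theorem stmt_15 {n : ℕ} [NeZero n] (hn : 3 ≤ n) (p : ℝ) (hp : (n : ℝ) - 1 < p)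
    (u : ℝ → ℝ) (hu : IsModelCusp u)
    (h f : Euc n → Euc n) (hhf : IsHomeoOn h f (unitBall n) (cuspBall n u))
    (Dh Df : Euc n → Matrix (Fin n) (Fin n) ℝ)
    (hSobH : MemSobolev (n : ℝ) (unitBall n) h Dh)
    (hSobF : MemSobolev p (cuspBall n u) f Df)
    (H : Euc n → Euc n) (hHc : ContinuousOn H (closure (unitBall n)))
    (hHmaps : Set.MapsTo H (closure (unitBall n)) (closure (cuspBall n u)))
    (hHeq : Set.EqOn H h (unitBall n)) :
    ∀ᵐ t ∂(volume.restrict (Set.Ioo (0 : ℝ) 1)),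
      ∃ U V : Set (Euc n),
        U ∪ V = Metric.sphere (0 : Euc n) 1 \ cuspC' n u h t ∧
        Disjoint U V ∧
        IsConnected U ∧ IsConnected V ∧
        (∃ U₀ : Set (Euc n), IsOpen U₀ ∧ U = U₀ ∩ Metric.sphere (0 : Euc n) 1) ∧
        (∃ V₀ : Set (Euc n), IsOpen V₀ ∧ V = V₀ ∩ Metric.sphere (0 : Euc n) 1) ∧
        closure U \ U = cuspC' n u h t ∧
        closure V \ V = cuspC' n u h t := by
  obtain ⟨m, rfl⟩ : ∃ m, n = m + 1 := ⟨n - 1, by omega⟩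
  have hcl : closure (unitBall (m + 1)) = closedBall (0 : Euc (m + 1)) 1 := by
    rw [unitBall, closure_ball _ one_ne_zero]
  have hm : 2 ≤ m := by omega
  rw [hcl] at hHc hHmaps
  have hcl2 : closure (cuspBall (m + 1) u) = cuspD m u := closure_cuspBall hu
  have hE : ExtData m u h f H :=
    ⟨hu, hhf, hHc, fun x hx => hcl2 ▸ hHmaps hx, hHeq⟩
  have hp' : (m : ℝ) < p := by
    push_cast at hp; linarith
  exact main_aux hm hp' hE hSobF
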